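/- Assume the Riemann Hypothesis. There is an absolute constant C > 0 such that for all sufficiently large t and all 0 < h ≤ √t with t and t+h not ordinates of zeros of ζ: |S(t+h) - S(t)| ≤ (1/2)·(log t)/(log log t) + C·(log t · log log log t)/(log log t)². -/

import Mathlib

open Complex MeasureTheory Real

/-- The argument function `S(t) = -(1/π) ∫_{1/2}^∞ Im(ζ'/ζ)(σ+it) dσ`. -/
noncomputable def S (t : ℝ) : ℝ :=
  -(1 / π) * ∫ σ in Set.Ioi (1 / 2 : ℝ),
    (deriv riemannZeta ((σ : ℂ) + (t : ℂ) * Complex.I) /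
      riemannZeta ((σ : ℂ) + (t : ℂ) * Complex.I)).im

/-- `t` is the ordinate of a nontrivial zero of the Riemann zeta function. -/
def IsZetaZeroOrdinate (t : ℝ) : Prop :=
  ∃ ρ : ℂ, riemannZeta ρ = 0 ∧ 0 < ρ.re ∧ ρ.re < 1 ∧ ρ.im = t

theorem norm_sin_le_exp_abs_im (w : ℂ) : ‖Complex.sin w‖ ≤ Real.exp |w.im| := by
  have h1 : ‖Complex.exp (-w * I)‖ ≤ Real.exp |w.im| := by
    rw [Complex.norm_exp]
    exact Real.exp_le_exp.2 (by simpa using le_abs_self w.im)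
  have h2 : ‖Complex.exp (w * I)‖ ≤ Real.exp |w.im| := by
    rw [Complex.norm_exp]
    exact Real.exp_le_exp.2 (by simpa using neg_le_abs w.im)
  have h3 := norm_sub_le (Complex.exp (-w * I)) (Complex.exp (w * I))
  rw [Complex.sin, norm_div, norm_mul, Complex.norm_I, mul_one, Complex.norm_ofNat]
  linarith

theorem norm_GammaSeq (s : ℂ) {n : ℕ} (hn : n ≠ 0) :
    ‖Complex.GammaSeq s n‖ =
      (n : ℝ) ^ s.re * n.factorial / ∏ j ∈ Finset.range (n + 1), ‖s + j‖ := by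
  have hn' : (0 : ℝ) < n := by positivity
  rw [Complex.GammaSeq, norm_div, norm_mul, norm_prod, Complex.norm_natCast,
    ← Complex.norm_cpow_eq_rpow_re_of_pos hn']
  simp

theorem re_le_norm_add_nat {s : ℂ} (j : ℕ) : s.re + j ≤ ‖s + j‖ := by
  simpa using Complex.re_le_norm (s + j)

theorem norm_Gamma_le_Gamma_re {s : ℂ} (hs : 0 < s.re) :
    ‖Complex.Gamma s‖ ≤ Real.Gamma s.re := by
  have h1 := (Complex.GammaSeq_tendsto_Gamma s).norm
  have h2 := (Complex.GammaSeq_tendsto_Gamma (s.re : ℂ)).norm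
  have h3 : ‖Complex.Gamma (s.re : ℂ)‖ = Real.Gamma s.re := by
    rw [Complex.Gamma_ofReal, Complex.norm_real, Real.norm_of_nonneg (Real.Gamma_pos_of_pos hs).le]
  rw [← h3]
  refine le_of_tendsto_of_tendsto h1 h2 ?_
  filter_upwards [Filter.eventually_ne_atTop 0] with n hn
  rw [norm_GammaSeq _ hn, norm_GammaSeq _ hn, Complex.ofReal_re]
  have hj : ∀ j : ℕ, ‖(s.re : ℂ) + j‖ = s.re + j := fun j => by
    rw [← Complex.ofReal_natCast, ← Complex.ofReal_add, Complex.norm_real,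
      Real.norm_of_nonneg (by positivity)]
  have : ∏ j ∈ Finset.range (n + 1), ‖(s.re : ℂ) + j‖ ≤ ∏ j ∈ Finset.range (n + 1), ‖s + j‖ :=
    Finset.prod_le_prod (fun _ _ => norm_nonneg _) fun j _ => by
      rw [hj]; exact re_le_norm_add_nat j
  have hp : 0 < ∏ j ∈ Finset.range (n + 1), ‖(s.re : ℂ) + j‖ :=
    Finset.prod_pos fun j _ => by rw [hj]; positivity
  gcongr

theorem add_div_norm_mono {a b y : ℝ} (ha : 0 < a) (hab : a ≤ b) :
    a * ‖(b : ℂ) + y * I‖ ≤ b * ‖(a : ℂ) + y * I‖ := by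
  have hb : 0 < b := ha.trans_le hab
  rw [Complex.norm_add_mul_I, Complex.norm_add_mul_I]
  refine le_of_sq_le_sq ?_ (by positivity)
  rw [mul_pow, mul_pow, Real.sq_sqrt (by positivity), Real.sq_sqrt (by positivity)]
  nlinarith [mul_le_mul hab hab ha.le hb.le, sq_nonneg y,
    mul_nonneg (sub_nonneg.2 (mul_le_mul hab hab ha.le hb.le)) (sq_nonneg y)]

theorem Gamma_mul_exp_le_norm_Gamma {x : ℝ} (y : ℝ) (hx : 1 / 2 ≤ x) :
    Real.Gamma x * Real.exp (-(π * |y| / 2)) ≤ ‖Complex.Gamma (x + y * I)‖ := by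
  have hx0 : 0 < x := by linarith
  have key : Real.Gamma x * ‖Complex.Gamma ((1 / 2 : ℝ) + y * I)‖ ≤
      Real.Gamma (1 / 2) * ‖Complex.Gamma (x + y * I)‖ := by
    have e : ∀ u : ℝ, 0 < u → ‖Complex.Gamma (u : ℂ)‖ = Real.Gamma u := fun u hu => by
      rw [Complex.Gamma_ofReal, Complex.norm_real, Real.norm_of_nonneg (Real.Gamma_pos_of_pos hu).le]
    rw [← e x hx0, ← e (1 / 2) (by norm_num)]
    refine le_of_tendsto_of_tendsto
      ((Complex.GammaSeq_tendsto_Gamma _).norm.mul (Complex.GammaSeq_tendsto_Gamma _).norm)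
      ((Complex.GammaSeq_tendsto_Gamma _).norm.mul (Complex.GammaSeq_tendsto_Gamma _).norm) ?_
    filter_upwards [Filter.eventually_ne_atTop 0] with n hn
    simp only [norm_GammaSeq _ hn]
    have hpos : ∀ u : ℝ, 0 < u → ∀ v : ℝ, 0 < ∏ j ∈ Finset.range (n + 1), ‖(u : ℂ) + v * I + j‖ :=
      fun u hu v => Finset.prod_pos fun j _ => by
        have := re_le_norm_add_nat (s := (u : ℂ) + v * I) j
        simp at this
        have : (0 : ℝ) < u + j := by positivity
        linarith
    have h1 := hpos x hx0 0
    have h2 := hpos (1 / 2) (by norm_num) 0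
    have h3 := hpos x hx0 y
    have h4 := hpos (1 / 2) (by norm_num) y
    simp only [Complex.ofReal_zero, zero_mul, add_zero] at h1 h2
    have hprod : (∏ j ∈ Finset.range (n + 1), ‖((1 / 2 : ℝ) : ℂ) + j‖) *
        (∏ j ∈ Finset.range (n + 1), ‖(x : ℂ) + y * I + j‖) ≤
        (∏ j ∈ Finset.range (n + 1), ‖(x : ℂ) + j‖) *
        (∏ j ∈ Finset.range (n + 1), ‖((1 / 2 : ℝ) : ℂ) + y * I + j‖) := by
      rw [← Finset.prod_mul_distrib, ← Finset.prod_mul_distrib]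
      refine Finset.prod_le_prod (fun _ _ => by positivity) fun j _ => ?_
      have := add_div_norm_mono (a := 1 / 2 + j) (b := x + j) (y := y) (by positivity) (by linarith)
      have e1 : ∀ u : ℝ, 0 < u → ‖(u : ℂ) + j‖ = u + j := fun u hu => by
        rw [← Complex.ofReal_natCast, ← Complex.ofReal_add, Complex.norm_real,
          Real.norm_of_nonneg (by positivity)]
      have e2 : ∀ u : ℝ, ‖(u : ℂ) + y * I + j‖ = ‖((u + j : ℝ) : ℂ) + y * I‖ := fun u => by
        congr 1; push_cast; ring
      rw [e1 _ hx0, e1 _ (by norm_num), e2, e2]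
      exact this
    simp only [Complex.ofReal_re, Complex.add_re, Complex.mul_re, Complex.I_re, Complex.I_im,
      Complex.ofReal_im, mul_zero, zero_mul, sub_zero, add_zero]
    rw [div_mul_div_comm, div_mul_div_comm, div_le_div_iff₀ (by positivity) (by positivity)]
    nlinarith [mul_le_mul_of_nonneg_left hprod
      (by positivity : 0 ≤ (n : ℝ) ^ x * n.factorial * ((n : ℝ) ^ (1 / 2 : ℝ) * n.factorial))]
  have hhalf : Real.sqrt π * Real.exp (-(π * |y| / 2)) ≤
      ‖Complex.Gamma ((1 / 2 : ℝ) + y * I)‖ := by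
    have h := Complex.Gamma_mul_Gamma_one_sub ((1 / 2 : ℝ) + y * I)
    have hc : (1 : ℂ) - ((1 / 2 : ℝ) + y * I) = (starRingEnd ℂ) ((1 / 2 : ℝ) + y * I) := by
      apply Complex.ext
      · simp; norm_num
      · simp
    rw [hc, Complex.Gamma_conj] at h
    have h' := congrArg norm h
    rw [norm_mul, RCLike.norm_conj, norm_div, Complex.norm_real, Real.norm_of_nonneg pi_pos.le] at h'
    have hs := norm_sin_le_exp_abs_im (π * ((1 / 2 : ℝ) + y * I))
    have him : ((π : ℂ) * ((1 / 2 : ℝ) + y * I)).im = π * y := by simp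
    rw [him, abs_mul, abs_of_pos pi_pos] at hs
    refine le_of_sq_le_sq ?_ (norm_nonneg _)
    rw [mul_pow, Real.sq_sqrt pi_pos.le, ← Real.exp_nat_mul, sq ‖_‖, h']
    have hs0 : 0 < ‖Complex.sin (π * ((1 / 2 : ℝ) + y * I))‖ := by
      rcases (norm_nonneg (Complex.sin (π * ((1 / 2 : ℝ) + y * I)))).eq_or_lt with h0 | h0
      · rw [← h0, div_zero, mul_self_eq_zero, norm_eq_zero] at h'
        exact absurd h' (Complex.Gamma_ne_zero_of_re_pos (by simp))
      · exact h0
    rw [le_div_iff₀ hs0]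
    calc π * Real.exp ((2 : ℕ) * -(π * |y| / 2)) * _ ≤
        π * Real.exp ((2 : ℕ) * -(π * |y| / 2)) * Real.exp (π * |y|) := by gcongr
      _ = π := by
        rw [mul_assoc, ← Real.exp_add, show ((2 : ℕ) : ℝ) * -(π * |y| / 2) + π * |y| = 0 by
          push_cast; ring, Real.exp_zero, mul_one]
  have hπ : 0 < Real.sqrt π := Real.sqrt_pos.2 pi_pos
  rw [Real.Gamma_one_half_eq] at key
  have hG := Real.Gamma_pos_of_pos hx0
  have := mul_le_mul_of_nonneg_left hhalf hG.le
  nlinarith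

theorem norm_rpow_mul_norm_rpow_le {x y h : ℝ} (hx : 0 < x) (hxy : |y| ≤ x) (h0 : 0 ≤ h)
    (h1 : h ≤ 1) :
    ‖(x : ℂ) + y * I‖ ^ (1 - h) * ‖((x + 1 : ℝ) : ℂ) + y * I‖ ^ h ≤
      ‖((x + h : ℝ) : ℂ) + y * I‖ := by
  have hconc : ConcaveOn ℝ (Set.Ici x) (fun u => Real.log (u ^ 2 + y ^ 2)) := by
    have hd : ∀ u ∈ Set.Ici x, HasDerivAt (fun u => Real.log (u ^ 2 + y ^ 2))
        (2 * u / (u ^ 2 + y ^ 2)) u := fun u hu => by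
      have hu : x ≤ u := hu
      have := (((hasDerivAt_id u).pow 2).add_const (y ^ 2)).log
        (by have : 0 < u := by linarith
            simp; positivity)
      simpa using this
    refine AntitoneOn.concaveOn_of_deriv (convex_Ici x)
      (fun u hu => (hd u hu).continuousAt.continuousWithinAt)
      (fun u hu => (hd u (interior_subset hu)).differentiableAt.differentiableWithinAt) ?_
    intro u hu v hv huv
    rw [(hd u (interior_subset hu)).deriv, (hd v (interior_subset hv)).deriv]
    have hu : x ≤ u := interior_subset hu
    have hu0 : 0 < u := by linarith
    have hv0 : 0 < v := by linarith
    rw [div_le_div_iff₀ (by positivity) (by positivity)]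
    have : y ^ 2 ≤ u * v := by
      rw [← sq_abs, sq]; exact mul_le_mul (by linarith) (by linarith) (abs_nonneg _) hu0.le
    nlinarith [mul_nonneg (sub_nonneg.2 huv) (sub_nonneg.2 this)]
  have h2 := hconc.2 (Set.mem_Ici.2 le_rfl) (Set.mem_Ici.2 (by linarith : x ≤ x + 1))
    (sub_nonneg.2 h1) h0 (sub_add_cancel 1 h)
  have e : ∀ u : ℝ, 0 < u → Real.log (u ^ 2 + y ^ 2) = 2 * Real.log ‖(u : ℂ) + y * I‖ := by
    intro u hu
    rw [Complex.norm_add_mul_I, Real.log_sqrt (by positivity)]; ring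
  have hpos : ∀ u : ℝ, 0 < u → 0 < ‖(u : ℂ) + y * I‖ := fun u hu => by
    rw [Complex.norm_add_mul_I]; positivity
  have e3 : (1 - h) • x + h • (x + 1) = x + h := by simp; ring
  rw [e3] at h2
  simp only [smul_eq_mul] at h2
  rw [e _ hx, e _ (by positivity), e _ (by positivity)] at h2
  rw [← Real.log_le_log_iff (mul_pos (Real.rpow_pos_of_pos (hpos _ hx) _)
    (Real.rpow_pos_of_pos (hpos _ (by positivity)) _)) (hpos _ (by positivity)),
    Real.log_mul (Real.rpow_pos_of_pos (hpos _ hx) _).ne'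
    (Real.rpow_pos_of_pos (hpos _ (by positivity)) _).ne', Real.log_rpow (hpos _ hx),
    Real.log_rpow (hpos _ (by positivity))]
  linarith

theorem norm_Gamma_add_le {x y h : ℝ} (hx : 0 < x) (h0 : 0 ≤ h) (h1 : h ≤ 1) :
    ‖Complex.Gamma (((x + h : ℝ) : ℂ) + y * I)‖ ≤
      ‖Complex.Gamma ((x : ℂ) + y * I)‖ * (x + 1 + 2 * |y|) ^ h := by
  set N : ℝ → ℝ := fun u => ‖(u : ℂ) + y * I‖ with hN
  have hpos : ∀ u : ℝ, 0 < u → 0 < N u := fun u hu => by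
    simp only [hN]; rw [Complex.norm_add_mul_I]; positivity
  have hmono : ∀ u v : ℝ, 0 < u → u ≤ v → N u ≤ N v := fun u v hu huv => by
    simp only [hN]; rw [Complex.norm_add_mul_I, Complex.norm_add_mul_I]; gcongr
  set J := ⌈|y|⌉₊ with hJ
  have hind : ∀ m, J ≤ m → (∏ j ∈ Finset.range m, N (x + j)) * N (x + m) ^ h ≤
      N (x + J) ^ h * ∏ j ∈ Finset.range m, N (x + h + j) := by
    intro m hm
    induction m, hm using Nat.le_induction with
    | base =>
      rw [mul_comm]
      refine mul_le_mul_of_nonneg_left (Finset.prod_le_prod (fun _ _ => norm_nonneg _)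
        fun j _ => hmono _ _ (by positivity) (by linarith)) (Real.rpow_nonneg (norm_nonneg _) _)
    | succ m hm ih =>
      rw [Finset.prod_range_succ, Finset.prod_range_succ]
      have hym : |y| ≤ x + m := by
        have := Nat.le_ceil |y|
        have h2 : (J : ℝ) ≤ m := by exact_mod_cast hm
        linarith
      have hc := norm_rpow_mul_norm_rpow_le (x := x + m) (y := y) (by positivity) hym h0 h1
      have hc' : N (x + m) ^ (1 - h) * N (x + (m + 1 : ℕ)) ^ h ≤ N (x + h + m) := by
        have e1 : x + ((m + 1 : ℕ) : ℝ) = x + m + 1 := by push_cast; ring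
        have e2 : x + h + m = x + m + h := by ring
        rw [e1, e2]; exact hc
      have hs : N (x + m) = N (x + m) ^ h * N (x + m) ^ (1 - h) := by
        rw [← Real.rpow_add (hpos _ (by positivity))]; simp
      calc _ = (∏ j ∈ Finset.range m, N (x + j)) * (N (x + m) ^ h * N (x + m) ^ (1 - h)) *
            N (x + (m + 1 : ℕ)) ^ h := by rw [← hs]
        _ = ((∏ j ∈ Finset.range m, N (x + j)) * N (x + m) ^ h) *
            (N (x + m) ^ (1 - h) * N (x + (m + 1 : ℕ)) ^ h) := by ring
        _ ≤ (N (x + J) ^ h * ∏ j ∈ Finset.range m, N (x + h + j)) * N (x + h + m) := by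
            refine mul_le_mul ih hc' ?_ ?_
            · have := Real.rpow_nonneg (hpos (x + m) (by positivity)).le (1 - h)
              have := Real.rpow_nonneg (hpos (x + (m + 1 : ℕ)) (by positivity)).le h
              positivity
            · exact mul_nonneg (Real.rpow_nonneg (norm_nonneg _) _)
                (Finset.prod_nonneg fun _ _ => norm_nonneg _)
        _ = _ := by ring
  have hNJ : N (x + J) ≤ x + 1 + 2 * |y| := by
    have h1 := norm_add_le (((x + J : ℝ) : ℂ)) (y * I)
    have h2 := (Nat.ceil_lt_add_one (abs_nonneg y)).le
    rw [Complex.norm_real, Real.norm_of_nonneg (by positivity), norm_mul, Complex.norm_I, mul_one,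
      Complex.norm_real, Real.norm_eq_abs] at h1
    simp only [hN]; linarith
  have hle : ‖Complex.Gamma (((x + h : ℝ) : ℂ) + y * I)‖ ≤
      ‖Complex.Gamma ((x : ℂ) + y * I)‖ * N (x + J) ^ h := by
    refine le_of_tendsto_of_tendsto (Complex.GammaSeq_tendsto_Gamma _).norm
      ((Complex.GammaSeq_tendsto_Gamma _).norm.mul_const _) ?_
    filter_upwards [Filter.eventually_ge_atTop (J + 1)] with n hn
    have hn0 : n ≠ 0 := by omega
    have hnpos : (0 : ℝ) < n := by positivity
    rw [norm_GammaSeq _ hn0, norm_GammaSeq _ hn0]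
    have hi := hind (n + 1) (by omega)
    have eN : ∀ u : ℝ, ∀ j : ℕ, ‖(u : ℂ) + y * I + j‖ = N (u + j) := fun u j => by
      simp only [hN]; congr 1; push_cast; ring
    simp only [eN]
    simp only [Complex.ofReal_re, Complex.add_re, Complex.mul_re, Complex.I_re, Complex.I_im,
      Complex.ofReal_im, mul_zero, zero_mul, sub_zero, add_zero]
    have hp1 : 0 < ∏ j ∈ Finset.range (n + 1), N (x + j) :=
      Finset.prod_pos fun j _ => hpos _ (by positivity)
    have hp2 : 0 < ∏ j ∈ Finset.range (n + 1), N (x + h + j) :=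
      Finset.prod_pos fun j _ => hpos _ (by positivity)
    rw [div_mul_eq_mul_div, div_le_div_iff₀ hp2 hp1, Real.rpow_add hnpos]
    have hnN : (n : ℝ) ^ h ≤ N (x + (n + 1 : ℕ)) ^ h := by
      refine Real.rpow_le_rpow hnpos.le ?_ h0
      have := re_le_norm_add_nat (s := (x : ℂ) + y * I) (n + 1)
      rw [eN] at this
      simp at this ⊢
      linarith
    calc (n : ℝ) ^ x * (n : ℝ) ^ h * n.factorial * ∏ j ∈ Finset.range (n + 1), N (x + j)
        ≤ (n : ℝ) ^ x * N (x + (n + 1 : ℕ)) ^ h * n.factorial *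
          ∏ j ∈ Finset.range (n + 1), N (x + j) := by gcongr
      _ = (n : ℝ) ^ x * n.factorial *
          ((∏ j ∈ Finset.range (n + 1), N (x + j)) * N (x + (n + 1 : ℕ)) ^ h) := by ring
      _ ≤ (n : ℝ) ^ x * n.factorial *
          (N (x + J) ^ h * ∏ j ∈ Finset.range (n + 1), N (x + h + j)) := by gcongr
      _ = _ := by ring
  refine hle.trans ?_
  gcongr

theorem Real.Gamma_le_exp_rpow {x : ℝ} (hx : 1 ≤ x) :
    Real.Gamma x ≤ Real.exp (2 * (x + 1) ^ (3 / 2 : ℝ)) := by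
  have hx0 : 0 < x := by linarith
  have h1 : Real.Gamma x ≤ Real.Gamma (x + 1) := by
    rw [Real.Gamma_add_one hx0.ne']
    nlinarith [Real.Gamma_pos_of_pos hx0]
  have h2 : Real.Gamma (x + 1) ≤ Real.Gamma (⌊x + 1⌋₊ + 1) :=
    Real.Gamma_strictMonoOn_Ici.monotoneOn (by simp; linarith)
      (by
        have : 1 ≤ ⌊x + 1⌋₊ := Nat.le_floor (by push_cast; linarith)
        have : (1 : ℝ) ≤ ⌊x + 1⌋₊ := by exact_mod_cast this
        simp; linarith) (Nat.lt_floor_add_one _).le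
  rw [Real.Gamma_nat_eq_factorial] at h2
  have h3 : ((⌊x + 1⌋₊.factorial : ℕ) : ℝ) ≤ (⌊x + 1⌋₊ : ℝ) ^ ⌊x + 1⌋₊ := by
    exact_mod_cast Nat.factorial_le_pow _
  have hfl : (⌊x + 1⌋₊ : ℝ) ≤ x + 1 := Nat.floor_le (by linarith)
  have h4 : (⌊x + 1⌋₊ : ℝ) ^ ⌊x + 1⌋₊ ≤ (x + 1) ^ (x + 1) := by
    rw [← Real.rpow_natCast]
    calc (⌊x + 1⌋₊ : ℝ) ^ (⌊x + 1⌋₊ : ℝ) ≤ (x + 1) ^ (⌊x + 1⌋₊ : ℝ) := by gcongr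
      _ ≤ _ := Real.rpow_le_rpow_of_exponent_le (by linarith) hfl
  have h5 : (x + 1) ^ (x + 1) ≤ Real.exp (2 * (x + 1) ^ (3 / 2 : ℝ)) := by
    rw [Real.rpow_def_of_pos (by linarith)]
    refine Real.exp_le_exp.2 ?_
    have h6 : Real.log (x + 1) ≤ (x + 1) ^ (1 / 2 : ℝ) / (1 / 2) :=
      Real.log_le_rpow_div (by linarith) (by norm_num)
    have h7 : (x + 1) ^ (3 / 2 : ℝ) = (x + 1) ^ (1 / 2 : ℝ) * (x + 1) := by
      rw [show (3 / 2 : ℝ) = 1 / 2 + 1 by norm_num, Real.rpow_add (by linarith), Real.rpow_one]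
    rw [h7]
    nlinarith
  linarith

theorem norm_riemannZeta_sub_one_le {s : ℂ} (hs : 2 ≤ s.re) : ‖riemannZeta s - 1‖ ≤ 2 / 3 := by
  have h1 : 1 < s.re := by linarith
  have hsum : Summable fun n : ℕ => ‖1 / ((n : ℂ) + 1) ^ s‖ := by
    have := (Complex.summable_one_div_nat_cpow (p := s)).2 h1
    simpa using ((summable_nat_add_iff 1).2 this).norm
  have h2 : HasSum (fun n : ℕ => 1 / ((n : ℝ) + 1) ^ 2) (π ^ 2 / 6) := by
    simpa using (hasSum_nat_add_iff' 1).2 hasSum_zeta_two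
  have h3 : HasSum (fun n : ℕ => 1 / ((n : ℝ) + 2) ^ 2) (π ^ 2 / 6 - 1) := by
    have := (hasSum_nat_add_iff' 1).2 h2
    simp only [Finset.sum_range_one, Nat.cast_zero, zero_add, one_pow, div_one] at this
    have e : (fun n : ℕ => 1 / ((n : ℝ) + 2) ^ 2) = fun n : ℕ => 1 / (((n + 1 : ℕ) : ℝ) + 1) ^ 2 := by
      funext n
      push_cast
      ring
    rw [e]
    exact this
  rw [zeta_eq_tsum_one_div_nat_add_one_cpow h1, hsum.of_norm.tsum_eq_zero_add]
  simp only [Nat.cast_zero, zero_add, one_cpow, div_one, add_sub_cancel_left]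
  have h4 : Summable fun n : ℕ => ‖1 / (((n + 1 : ℕ) : ℂ) + 1) ^ s‖ :=
    (summable_nat_add_iff 1).2 hsum
  refine (norm_tsum_le_tsum_norm h4).trans ?_
  refine (h4.tsum_le_tsum (fun n => ?_) h3.summable).trans ?_
  · have h5 : (((n + 1 : ℕ) : ℂ) + 1) = (((n : ℝ) + 2 : ℝ) : ℂ) := by push_cast; ring
    rw [h5, norm_div, norm_one, Complex.norm_cpow_eq_rpow_re_of_pos (by positivity)]
    gcongr
    rw [← Real.rpow_natCast]
    exact Real.rpow_le_rpow_of_exponent_le (by linarith [n.cast_nonneg (α := ℝ)]) (by simpa using hs)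
  · rw [h3.tsum_eq]
    nlinarith [Real.pi_lt_d2, Real.pi_pos]

/-- The completed zeta function multiplied by `s * (s - 1)`, as an entire function. -/
noncomputable def xi (s : ℂ) : ℂ := s * (s - 1) * completedRiemannZeta₀ s + 1

theorem differentiable_xi : Differentiable ℂ xi := by
  unfold xi
  exact ((differentiable_id.mul (differentiable_id.sub_const 1)).mul
    differentiable_completedZeta₀).add_const 1

theorem xi_one_sub (s : ℂ) : xi (1 - s) = xi s := by
  simp only [xi, completedRiemannZeta₀_one_sub]
  ring

theorem xi_eq {s : ℂ} (hs : 0 < s.re) (h1 : s ≠ 1) :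
    xi s = s * (s - 1) * Gammaℝ s * riemannZeta s := by
  have h0 : s ≠ 0 := by rintro rfl; simp at hs
  have h1' : 1 - s ≠ 0 := sub_ne_zero.2 h1.symm
  rw [riemannZeta_def_of_ne_zero h0, completedRiemannZeta_eq, xi]
  have := Gammaℝ_ne_zero_of_re_pos hs
  field_simp
  ring

open ComplexConjugate in
theorem Gammaℝ_conj (s : ℂ) : Gammaℝ (conj s) = conj (Gammaℝ s) := by
  rw [Gammaℝ_def, Gammaℝ_def, map_mul, ← Complex.Gamma_conj]
  congr 1
  · rw [← Complex.ofReal_ofNat, ← map_neg]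
    have : (starRingEnd ℂ) (-s) / ((2 : ℝ) : ℂ) = conj (-s / ((2 : ℝ) : ℂ)) := by
      rw [map_div₀, Complex.conj_ofReal]
    rw [this, Complex.cpow_conj _ _ (by
      rw [Complex.arg_ofReal_of_nonneg Real.pi_pos.le]; exact Real.pi_pos.ne), Complex.conj_ofReal]
  · rw [map_div₀, ← Complex.ofReal_ofNat, Complex.conj_ofReal]

open ComplexConjugate in
theorem xi_conj (s : ℂ) : xi (conj s) = conj (xi s) := by
  have key : ∀ s : ℂ, 0 < s.re → xi (conj s) = conj (xi s) := by
    intro s hs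
    by_cases h1 : s = 1
    · simp [h1, xi]
    · rw [xi_eq hs h1, xi_eq (by simpa using hs) (by
        intro h; apply h1; simpa using congrArg conj h), Gammaℝ_conj, riemannZeta_conj]
      simp
  by_cases hs : 0 < s.re
  · exact key s hs
  · have := key (1 - s) (by simp; linarith)
    rw [map_sub, map_one, xi_one_sub, xi_one_sub] at this
    exact this

theorem exists_norm_completedRiemannZeta₀_le (a b : ℝ) :
    ∃ M : ℝ, 0 ≤ M ∧ ∀ s : ℂ, a ≤ s.re → s.re ≤ b → ‖completedRiemannZeta₀ s‖ ≤ M := by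
  set P := HurwitzZeta.hurwitzEvenFEPair 0
  have hconv : ∀ x : ℝ, IntegrableOn (fun t : ℝ => t ^ (x - 1) * ‖P.f_modif t‖) (Set.Ioi 0) := by
    intro x
    have h := (P.isStrongFEPair_toStrongFEPair.hasMellin (x : ℂ)).1
    refine IntegrableOn.congr_fun (s := Set.Ioi 0) h.norm (fun t ht => ?_) measurableSet_Ioi
    rw [Set.mem_Ioi] at ht
    simp only [norm_smul]
    rw [Complex.norm_cpow_eq_rpow_re_of_pos ht]
    simp [WeakFEPair.toStrongFEPair]
  refine ⟨(∫ t in Set.Ioi (0 : ℝ), (t ^ (a / 2 - 1) * ‖P.f_modif t‖ +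
    t ^ (b / 2 - 1) * ‖P.f_modif t‖)) / 2, ?_, fun s ha hb => ?_⟩
  · refine div_nonneg (setIntegral_nonneg measurableSet_Ioi fun t ht => ?_) zero_le_two
    rw [Set.mem_Ioi] at ht
    positivity
  · have : completedRiemannZeta₀ s = (P.Λ₀ (s / 2)) / 2 := rfl
    rw [this, norm_div, Complex.norm_ofNat, WeakFEPair.Λ₀, mellin]
    gcongr
    refine norm_integral_le_of_norm_le ((hconv _).add (hconv _)) ?_
    refine (ae_restrict_iff' measurableSet_Ioi).2 (Filter.Eventually.of_forall fun t ht => ?_)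
    rw [Set.mem_Ioi] at ht
    rw [norm_smul, Complex.norm_cpow_eq_rpow_re_of_pos ht, ← add_mul]
    have hre : (s / 2 - 1).re = s.re / 2 - 1 := by simp
    rw [hre]
    refine mul_le_mul_of_nonneg_right ?_ (norm_nonneg _)
    rcases le_total t 1 with h | h
    · have := Real.rpow_le_rpow_of_exponent_ge ht h (show a / 2 - 1 ≤ s.re / 2 - 1 by linarith)
      linarith [Real.rpow_nonneg ht.le (b / 2 - 1)]
    · have := Real.rpow_le_rpow_of_exponent_le h (show s.re / 2 - 1 ≤ b / 2 - 1 by linarith)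
      linarith [Real.rpow_nonneg ht.le (a / 2 - 1)]

theorem norm_Gammaℝ_le {s : ℂ} (hs : 0 < s.re) : ‖Gammaℝ s‖ ≤ Real.Gamma (s.re / 2) := by
  have h2 : (s / 2).re = s.re / 2 := by simp
  rw [Gammaℝ_def, norm_mul, Complex.norm_cpow_eq_rpow_re_of_pos Real.pi_pos]
  have h1 : π ^ (-s / 2).re ≤ 1 := by
    apply Real.rpow_le_one_of_one_le_of_nonpos (by linarith [Real.pi_gt_three])
    simp; linarith
  have h3 := norm_Gamma_le_Gamma_re (s := s / 2) (by rw [h2]; linarith)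
  rw [h2] at h3
  nlinarith [norm_nonneg (Complex.Gamma (s / 2))]

theorem exists_norm_xi_le :
    ∃ C : ℝ, 0 ≤ C ∧ ∀ s : ℂ, ‖xi s‖ ≤ Real.exp (C * (2 + ‖s‖) ^ (3 / 2 : ℝ)) := by
  obtain ⟨M, hM0, hM⟩ := exists_norm_completedRiemannZeta₀_le (1 / 2) 2
  have key : ∀ s : ℂ, 1 / 2 ≤ s.re →
      ‖xi s‖ ≤ Real.exp ((6 + M) * (1 + ‖s‖) ^ (3 / 2 : ℝ) + (6 + M)) := by
    intro s hs
    have hr := norm_nonneg s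
    set r := ‖s‖
    have h1 : ‖s - 1‖ ≤ 1 + r := by
      have := norm_sub_le s 1
      rw [norm_one] at this; linarith
    have hpr : 1 + r ≤ (1 + r) ^ (3 / 2 : ℝ) :=
      Real.self_le_rpow_of_one_le (by linarith) (by norm_num)
    have he : r * ‖s - 1‖ ≤ Real.exp (2 * (1 + r)) := by
      have h2 : 1 + r ≤ Real.exp (1 + r) := by linarith [Real.add_one_le_exp (1 + r)]
      calc r * ‖s - 1‖ ≤ (1 + r) * (1 + r) := by gcongr; linarith
        _ ≤ Real.exp (1 + r) * Real.exp (1 + r) := by gcongr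
        _ = _ := by rw [← Real.exp_add]; ring_nf
    rcases le_or_gt s.re 2 with h2 | h2
    · have h3 : ‖xi s‖ ≤ Real.exp (2 * (1 + r)) * M + 1 := by
        rw [xi]
        refine (norm_add_le _ _).trans ?_
        rw [norm_mul, norm_mul, norm_one]
        gcongr
        exact hM s hs h2
      have h4 : (1 : ℝ) ≤ Real.exp (2 * (1 + r)) := Real.one_le_exp (by linarith)
      calc ‖xi s‖ ≤ Real.exp (2 * (1 + r)) * (M + 1) := by linarith
        _ ≤ Real.exp (2 * (1 + r)) * Real.exp M := by
          gcongr; exact Real.add_one_le_exp M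
        _ = Real.exp (2 * (1 + r) + M) := by rw [Real.exp_add]
        _ ≤ _ := by
          apply Real.exp_le_exp.2; nlinarith
    · have hne : s ≠ 1 := by rintro rfl; norm_num at h2
      rw [xi_eq (by linarith) hne, norm_mul, norm_mul, norm_mul]
      have hz : ‖riemannZeta s‖ ≤ Real.exp 1 := by
        have h3 := norm_riemannZeta_sub_one_le h2.le
        have h4 := norm_add_le (riemannZeta s - 1) 1
        rw [sub_add_cancel, norm_one] at h4
        linarith [Real.add_one_le_exp 1]
      have hg : ‖Gammaℝ s‖ ≤ Real.exp (2 * (1 + r) ^ (3 / 2 : ℝ)) := by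
        refine (norm_Gammaℝ_le (by linarith)).trans
          ((Real.Gamma_le_exp_rpow (by linarith)).trans ?_)
        gcongr Real.exp (2 * ?_)
        refine Real.rpow_le_rpow (by linarith) ?_ (by norm_num)
        · have := Complex.re_le_norm s
          change s.re ≤ r at this
          linarith
      calc r * ‖s - 1‖ * ‖Gammaℝ s‖ * ‖riemannZeta s‖
          ≤ Real.exp (2 * (1 + r)) * Real.exp (2 * (1 + r) ^ (3 / 2 : ℝ)) * Real.exp 1 := by gcongr
        _ = Real.exp (2 * (1 + r) + 2 * (1 + r) ^ (3 / 2 : ℝ) + 1) := by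
          rw [Real.exp_add, Real.exp_add]
        _ ≤ _ := by
          apply Real.exp_le_exp.2; nlinarith
  refine ⟨2 * (6 + M), by linarith, fun s => ?_⟩
  have hs0 := norm_nonneg s
  have h1 : (1 : ℝ) ≤ (2 + ‖s‖) ^ (3 / 2 : ℝ) := Real.one_le_rpow (by linarith) (by norm_num)
  have fin : ∀ w : ℂ, ‖w‖ ≤ 1 + ‖s‖ →
      (6 + M) * (1 + ‖w‖) ^ (3 / 2 : ℝ) + (6 + M) ≤ 2 * (6 + M) * (2 + ‖s‖) ^ (3 / 2 : ℝ) := by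
    intro w hw
    have : (1 + ‖w‖) ^ (3 / 2 : ℝ) ≤ (2 + ‖s‖) ^ (3 / 2 : ℝ) := by
      exact Real.rpow_le_rpow (by positivity) (by linarith) (by norm_num)
    nlinarith
  rcases le_total (1 / 2) s.re with h | h
  · exact (key s h).trans (Real.exp_le_exp.2 (fin s (by linarith)))
  · rw [← xi_one_sub]
    refine (key (1 - s) (by simp; linarith)).trans (Real.exp_le_exp.2 (fin _ ?_))
    simpa using norm_sub_le 1 s

theorem tsum_one_div_nat_add_one_rpow_le {s : ℝ} (hs : 1 < s) :
    ∑' n : ℕ, 1 / (n + 1 : ℝ) ^ s ≤ 1 + 1 / (s - 1) := by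
  have h := ZetaAsymptotics.zeta_limit_aux1 hs
  have h2 : 0 ≤ ZetaAsymptotics.termTSum s := tsum_nonneg fun n => ZetaAsymptotics.term_nonneg _ _
  nlinarith

theorem summable_one_div_nat_add_one_rpow {s : ℝ} (hs : 1 < s) :
    Summable fun n : ℕ => 1 / (n + 1 : ℝ) ^ s := by
  have := (summable_nat_add_iff 1).2 (Real.summable_one_div_nat_rpow.2 hs)
  simpa using this

theorem norm_deriv_zeta_div_zeta_le {δ : ℝ} (hδ : 0 < δ) (hδ1 : δ ≤ 1) {s : ℂ}
    (hs : 1 + δ ≤ s.re) :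
    ‖deriv riemannZeta s / riemannZeta s‖ ≤ 6 / δ ^ 2 * (2 : ℝ) ^ (-(s.re - 1 - δ)) := by
  have hs1 : 1 < s.re := by linarith
  have hsum := ArithmeticFunction.LSeriesSummable_vonMangoldt hs1
  have hb : ∀ n : ℕ, ‖LSeries.term (fun n => (ArithmeticFunction.vonMangoldt n : ℂ)) s (n + 1)‖ ≤
      (2 / δ * (2 : ℝ) ^ (-(s.re - 1 - δ))) * (1 / (n + 1 : ℝ) ^ (1 + δ / 2)) := by
    intro n
    rw [LSeries.term_of_ne_zero (Nat.succ_ne_zero n), norm_div, Complex.norm_real, Real.norm_eq_abs,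
      abs_of_nonneg ArithmeticFunction.vonMangoldt_nonneg, Complex.norm_natCast_cpow_of_pos (Nat.succ_pos n)]
    rcases Nat.eq_zero_or_pos n with rfl | hn
    · simp only [ArithmeticFunction.vonMangoldt_apply_one, zero_div]
      positivity
    · set x : ℝ := (n : ℝ) + 1
      have hx : (2 : ℝ) ≤ x := by
        have : (1 : ℝ) ≤ n := by exact_mod_cast hn
        simp only [x]; linarith
      have hx0 : 0 < x := by linarith
      have hc : ((n + 1 : ℕ) : ℝ) = x := by push_cast; rfl
      have h1 : ArithmeticFunction.vonMangoldt (n + 1) ≤ x ^ (δ / 2) / (δ / 2) := by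
        refine ArithmeticFunction.vonMangoldt_le_log.trans ?_
        rw [hc]
        exact Real.log_le_rpow_div hx0.le (by linarith)
      rw [hc]
      have h2 : x ^ (-(s.re - 1 - δ)) ≤ (2 : ℝ) ^ (-(s.re - 1 - δ)) :=
        Real.rpow_le_rpow_of_nonpos (by norm_num) hx (by linarith)
      calc _ ≤ x ^ (δ / 2) / (δ / 2) / x ^ s.re := by gcongr
        _ = (2 / δ * x ^ (-(s.re - 1 - δ))) * (1 / x ^ (1 + δ / 2)) := by
          have e1 : x ^ s.re = x ^ (s.re - 1 - δ) * x ^ (1 + δ / 2) * x ^ (δ / 2) := by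
            rw [← Real.rpow_add hx0, ← Real.rpow_add hx0]; congr 1; ring
          rw [Real.rpow_neg hx0.le, e1]
          have := Real.rpow_pos_of_pos hx0 (δ / 2)
          have := Real.rpow_pos_of_pos hx0 (s.re - 1 - δ)
          have := Real.rpow_pos_of_pos hx0 (1 + δ / 2)
          field_simp
        _ ≤ _ := by gcongr
  have hz := ArithmeticFunction.LSeries_vonMangoldt_eq_deriv_riemannZeta_div hs1
  have he : deriv riemannZeta s / riemannZeta s =
      -LSeries (fun n => (ArithmeticFunction.vonMangoldt n : ℂ)) s := by
    rw [hz]; ring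
  rw [he, norm_neg, LSeries, hsum.tsum_eq_zero_add, LSeries.term_zero, zero_add]
  have hps := summable_one_div_nat_add_one_rpow (s := 1 + δ / 2) (by linarith)
  refine (tsum_of_norm_bounded ((hps.mul_left _).hasSum) hb).trans ?_
  rw [tsum_mul_left]
  have h3 := tsum_one_div_nat_add_one_rpow_le (s := 1 + δ / 2) (by linarith)
  have h4 : 1 + 1 / (1 + δ / 2 - 1) ≤ 3 / δ := by
    rw [add_sub_cancel_left, le_div_iff₀ hδ, add_mul]
    field_simp
    linarith
  calc _ ≤ (2 / δ * (2 : ℝ) ^ (-(s.re - 1 - δ))) * (3 / δ) := by gcongr; exact h3.trans h4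
    _ = _ := by field_simp; ring

theorem RiemannHypothesis.ne_zero (hRH : RiemannHypothesis) {s : ℂ} (hs : 1 / 2 < s.re) :
    riemannZeta s ≠ 0 := by
  intro h
  by_cases h1 : s = 1
  · exact riemannZeta_one_ne_zero (h1 ▸ h)
  · have := hRH s h ?_ h1
    · linarith
    · rintro ⟨n, rfl⟩
      have : ((-2 * ((n : ℂ) + 1)).re) = -2 * ((n : ℝ) + 1) := by simp
      rw [this] at hs
      linarith [n.cast_nonneg (α := ℝ)]

theorem RiemannHypothesis.xi_ne_zero (hRH : RiemannHypothesis) {s : ℂ} (hs : 1 / 2 < s.re) :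
    xi s ≠ 0 := by
  by_cases h1 : s = 1
  · simp [h1, xi]
  · rw [xi_eq (by linarith) h1]
    have h0 : s ≠ 0 := by rintro rfl; norm_num at hs
    exact mul_ne_zero (mul_ne_zero (mul_ne_zero h0 (sub_ne_zero.2 h1))
      (Gammaℝ_ne_zero_of_re_pos (by linarith))) (hRH.ne_zero hs)

theorem mul_exp_le_norm_of_ne_zero_on_ball {f : ℂ → ℂ} (hf : Differentiable ℂ f) {c : ℂ}
    {R M m : ℝ} (hR : 0 < R) (hne : ∀ z ∈ Metric.ball c R, f z ≠ 0)
    (hM : ∀ z ∈ Metric.ball c R, ‖f z‖ ≤ Real.exp M) (hm : Real.exp (-m) ≤ ‖f c‖)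
    (hMm : 0 < M + m) {z : ℂ} (hz : z ∈ Metric.ball c R) :
    Real.exp (-m - 2 * (M + m) * ‖z - c‖ / (R - ‖z - c‖)) ≤ ‖f z‖ := by
  have hc : c ∈ Metric.ball c R := Metric.mem_ball_self hR
  have hd : DifferentiableOn ℂ (fun z => deriv f z / f z) (Metric.ball c R) :=
    (hf.deriv.differentiableOn).div hf.differentiableOn hne
  obtain ⟨g, hg⟩ := hd.isExactOn_ball
  have hconst : ∀ w ∈ Metric.ball c R, f w * Complex.exp (-(g w - g c)) = f c := by
    intro w hw
    have h1 : ∀ w ∈ Metric.ball c R,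
        HasDerivAt (fun w => f w * Complex.exp (-(g w - g c))) 0 w := by
      intro w hw
      have h2 := ((hf w).hasDerivAt).mul (((hg w hw).sub_const (g c)).neg.cexp)
      have h4 : f w * (Complex.exp (-(g w - g c)) * -(deriv f w / f w)) =
          -(deriv f w * Complex.exp (-(g w - g c))) := by
        have := hne w hw
        field_simp
      refine h2.congr_deriv ?_
      exact add_eq_zero_iff_eq_neg'.2 h4
    have h3 := (convex_ball c R).is_const_of_fderivWithin_eq_zero (𝕜 := ℂ)
      (f := fun w => f w * Complex.exp (-(g w - g c)))
      (fun w hw => (h1 w hw).differentiableAt.differentiableWithinAt) (fun w hw => by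
        rw [fderivWithin_of_isOpen Metric.isOpen_ball hw]
        rw [(h1 w hw).hasFDerivAt.fderiv]
        ext; simp) hw hc
    simpa using h3
  have hexp : ∀ w ∈ Metric.ball c R, f w = f c * Complex.exp (g w - g c) := by
    intro w hw
    rw [← hconst w hw, mul_assoc, ← Complex.exp_add]; simp
  have hfc : 0 < ‖f c‖ := norm_pos_iff.2 (hne c hc)
  have hbc := Complex.borelCaratheodory_zero (M := M + m) (f := fun z => g (c + z) - g c) (R := R)
    (z := z - c) hMm ?_ ?_ hR (by simpa [dist_eq_norm] using hz) (by simp)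
  · simp only [add_sub_cancel] at hbc
    rw [hexp z hz, norm_mul, Complex.norm_exp, sub_eq_add_neg, Real.exp_add]
    gcongr
    have := (abs_le.1 ((Complex.abs_re_le_norm (g z - g c)).trans hbc)).1
    exact this
  · intro w hw
    have hw' : c + w ∈ Metric.ball c R := by simpa [dist_eq_norm] using hw
    have := (hg (c + w) hw').differentiableAt
    exact ((this.comp w (by fun_prop)).sub_const _).differentiableWithinAt
  · intro w hw
    have hw' : c + w ∈ Metric.ball c R := by simpa [dist_eq_norm] using hw
    have h4 := hM _ hw'
    rw [hexp _ hw', norm_mul, Complex.norm_exp] at h4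
    have h5 : Real.exp (-m + (g (c + w) - g c).re) ≤ Real.exp M := by
      rw [Real.exp_add]
      refine le_trans ?_ h4
      gcongr
    have := Real.exp_le_exp.1 h5
    show (g (c + w) - g c).re ≤ M + m
    linarith

theorem exp_le_norm_xi {s : ℂ} (hs : 4 ≤ s.re) : Real.exp (-(2 * ‖s‖)) ≤ ‖xi s‖ := by
  have hne : s ≠ 1 := by rintro rfl; norm_num at hs
  have hre := Complex.re_le_norm s
  have him := Complex.abs_im_le_norm s
  rw [xi_eq (by linarith) hne, norm_mul, norm_mul, norm_mul, Gammaℝ_def, norm_mul,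
    Complex.norm_cpow_eq_rpow_re_of_pos Real.pi_pos]
  have h1 : (3 : ℝ) ≤ ‖s - 1‖ := by
    have := Complex.re_le_norm (s - 1)
    simp only [sub_re, one_re] at this
    linarith
  have h2 : (1 / 3 : ℝ) ≤ ‖riemannZeta s‖ := by
    have h3 := norm_riemannZeta_sub_one_le (s := s) (by linarith)
    have h4 := norm_sub_le (riemannZeta s) (riemannZeta s - 1)
    rw [sub_sub_cancel, norm_one] at h4
    linarith
  have h3 : Real.exp (-‖s‖) ≤ π ^ (-s / 2).re := by
    have e : (-s / 2).re = -s.re / 2 := by simp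
    have hl : Real.log π ≤ 2 := by
      rw [Real.log_le_iff_le_exp Real.pi_pos]
      have := Real.add_one_le_exp (1 : ℝ)
      have h2 : Real.exp 2 = Real.exp 1 * Real.exp 1 := by rw [← Real.exp_add]; norm_num
      nlinarith [Real.pi_lt_four]
    rw [e, Real.rpow_def_of_pos Real.pi_pos]
    apply Real.exp_le_exp.2
    nlinarith
  have h4 : Real.exp (-‖s‖) ≤ ‖Complex.Gamma (s / 2)‖ := by
    have e : s / 2 = ((s.re / 2 : ℝ) : ℂ) + ((s.im / 2 : ℝ) : ℂ) * I := by
      apply Complex.ext <;> simp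
    rw [e]
    refine le_trans ?_ (Gamma_mul_exp_le_norm_Gamma _ (by linarith))
    have h5 : 1 ≤ Real.Gamma (s.re / 2) := by
      rw [← Real.Gamma_two]
      exact Real.Gamma_strictMonoOn_Ici.monotoneOn (Set.mem_Ici.2 le_rfl)
        (Set.mem_Ici.2 (by linarith)) (by linarith)
    have h6 : Real.exp (-‖s‖) ≤ Real.exp (-(π * |s.im / 2| / 2)) := by
      apply Real.exp_le_exp.2
      rw [abs_div, abs_two]
      nlinarith [Real.pi_lt_four, abs_nonneg s.im]
    nlinarith [Real.exp_pos (-(π * |s.im / 2| / 2))]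
  have hE := Real.exp_pos (-‖s‖)
  calc Real.exp (-(2 * ‖s‖)) = 3 * (Real.exp (-‖s‖) * Real.exp (-‖s‖)) * (1 / 3) := by
        rw [← Real.exp_add]; ring_nf
    _ ≤ ‖s‖ * ‖s - 1‖ * (π ^ (-s / 2).re * ‖Complex.Gamma (s / 2)‖) * ‖riemannZeta s‖ := by
        gcongr
        nlinarith

theorem RiemannHypothesis.exists_exp_le_norm_xi (hRH : RiemannHypothesis) {a : ℝ} (ha : 0 < a) :
    ∃ K : ℝ, 0 ≤ K ∧ ∀ s : ℂ, 1 / 2 + a ≤ s.re →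
      Real.exp (-(K * (20 + ‖s‖) ^ (3 / 2 : ℝ))) ≤ ‖xi s‖ := by
  obtain ⟨C, hC0, hC⟩ := exists_norm_xi_le
  refine ⟨2 + 2 * (C + 2) * 8 / a, by positivity, fun s hs => ?_⟩
  set r := ‖s‖ with hr
  have hr0 : 0 ≤ r := norm_nonneg s
  have hpow : 20 + r ≤ (20 + r) ^ (3 / 2 : ℝ) :=
    Real.self_le_rpow_of_one_le (by linarith) (by norm_num)
  set W := (20 + r) ^ (3 / 2 : ℝ) with hW
  have hx : 0 ≤ 2 * (C + 2) * 8 / a := by positivity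
  rcases le_or_gt 4 s.re with h4 | h4
  · refine le_trans (Real.exp_le_exp.2 ?_) (exp_le_norm_xi h4)
    rw [← hr]
    nlinarith
  · set c : ℂ := ((17 / 2 : ℝ) : ℂ) + (s.im : ℂ) * I with hc
    have hcre : c.re = 17 / 2 := by simp [hc]
    have hcim : c.im = s.im := by simp [hc]
    have hcn : ‖c‖ ≤ 9 + r := by
      have h1 := Complex.norm_le_abs_re_add_abs_im c
      rw [hcre, hcim, abs_of_pos (by norm_num)] at h1
      linarith [Complex.abs_im_le_norm s]
    have hsc : ‖s - c‖ = 17 / 2 - s.re := by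
      have : s - c = ((s.re - 17 / 2 : ℝ) : ℂ) := by
        apply Complex.ext <;> simp [hcre, hcim]
      rw [this, Complex.norm_real, Real.norm_eq_abs, abs_of_nonpos (by linarith)]
      ring
    have hball : s ∈ Metric.ball c 8 := by
      rw [Metric.mem_ball, dist_eq_norm, hsc]; linarith
    have hrange : ∀ z ∈ Metric.ball c 8, 1 / 2 < z.re ∧ ‖z‖ ≤ 17 + r := by
      intro z hz
      rw [Metric.mem_ball, dist_eq_norm] at hz
      have h1 := (abs_le.1 (Complex.abs_re_le_norm (z - c))).1
      rw [sub_re, hcre] at h1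
      refine ⟨by linarith, ?_⟩
      have := norm_add_le (z - c) c
      rw [sub_add_cancel] at this
      linarith
    have key := mul_exp_le_norm_of_ne_zero_on_ball differentiable_xi (c := c) (R := 8)
      (M := C * W) (m := 2 * W) (by norm_num)
      (fun z hz => hRH.xi_ne_zero (hrange z hz).1) (fun z hz => ?_) ?_ (by nlinarith) hball
    · refine le_trans (Real.exp_le_exp.2 ?_) key
      rw [hsc]
      have h5 : (17 / 2 - s.re) / (8 - (17 / 2 - s.re)) ≤ 8 / a := by
        rw [div_le_div_iff₀ (by linarith) ha]
        nlinarith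
      have h6 : 2 * (C * W + 2 * W) * (17 / 2 - s.re) / (8 - (17 / 2 - s.re)) =
          2 * (C * W + 2 * W) * ((17 / 2 - s.re) / (8 - (17 / 2 - s.re))) := by ring
      have h7 : 2 * (C * W + 2 * W) * ((17 / 2 - s.re) / (8 - (17 / 2 - s.re))) ≤
          2 * (C * W + 2 * W) * (8 / a) := by
        gcongr
      rw [h6]
      have h8 : (2 + 2 * (C + 2) * 8 / a) * W = 2 * W + 2 * (C * W + 2 * W) * (8 / a) := by ring
      linarith
    · refine (hC z).trans (Real.exp_le_exp.2 ?_)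
      gcongr
      exact Real.rpow_le_rpow (by positivity) (by linarith [(hrange z hz).2]) (by norm_num)
    · refine le_trans (Real.exp_le_exp.2 ?_) (exp_le_norm_xi (by rw [hcre]; norm_num))
      linarith

theorem two_add_rpow_le {r A : ℝ} (hr : 0 ≤ r) (hA : 1 ≤ A) :
    (A + r) ^ (3 / 2 : ℝ) ≤ (2 * A) ^ (3 / 2 : ℝ) + 3 * r ^ (3 / 2 : ℝ) := by
  have h3 : (2 : ℝ) ^ (3 / 2 : ℝ) ≤ 3 := by
    have h := Real.rpow_le_rpow_of_exponent_le (x := 2) (by norm_num)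
      (show (3 / 2 : ℝ) ≤ (3 / 2 : ℝ) by norm_num)
    have e : ((2 : ℝ) ^ (3 / 2 : ℝ)) ^ 2 = 8 := by
      rw [← Real.rpow_natCast, ← Real.rpow_mul (by norm_num)]
      norm_num
    nlinarith [Real.rpow_nonneg (show (0 : ℝ) ≤ 2 by norm_num) (3 / 2)]
  rcases le_total r A with h | h
  · have := Real.rpow_le_rpow (by linarith) (show A + r ≤ 2 * A by linarith)
      (show (0 : ℝ) ≤ 3 / 2 by norm_num)
    linarith [Real.rpow_nonneg hr (3 / 2)]
  · have := Real.rpow_le_rpow (by linarith) (show A + r ≤ 2 * r by linarith)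
      (show (0 : ℝ) ≤ 3 / 2 by norm_num)
    rw [Real.mul_rpow (by norm_num) hr] at this
    have h0 : 0 ≤ (2 * A) ^ (3 / 2 : ℝ) := Real.rpow_nonneg (by linarith) _
    nlinarith [Real.rpow_nonneg hr (3 / 2)]

theorem norm_Gammaℝ_ofReal {x : ℝ} (hx : 0 < x) :
    ‖Gammaℝ (x : ℂ)‖ = π ^ (-x / 2) * Real.Gamma (x / 2) := by
  have e1 : -(x : ℂ) / 2 = ((-x / 2 : ℝ) : ℂ) := by push_cast; ring
  have e2 : (x : ℂ) / 2 = ((x / 2 : ℝ) : ℂ) := by push_cast; ring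
  rw [Gammaℝ_def, e1, e2, norm_mul, Complex.norm_cpow_eq_rpow_re_of_pos Real.pi_pos,
    Complex.Gamma_ofReal, Complex.norm_real, Complex.ofReal_re, Real.norm_eq_abs,
    abs_of_pos (Real.Gamma_pos_of_pos (by linarith))]

theorem norm_xi_ofReal_le {x y : ℝ} (hx : 4 ≤ x) (hxy : x ≤ y) :
    ‖xi (x : ℂ)‖ ≤ 5 * π ^ ((y - x) / 2) * ‖xi (y : ℂ)‖ := by
  have hz : ∀ x : ℝ, 4 ≤ x → ‖riemannZeta (x : ℂ) - 1‖ ≤ 2 / 3 := fun x hx =>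
    norm_riemannZeta_sub_one_le (by simp; linarith)
  have e : ∀ x : ℝ, 4 ≤ x → ‖xi (x : ℂ)‖ = x * (x - 1) * (π ^ (-x / 2) * Real.Gamma (x / 2)) *
      ‖riemannZeta (x : ℂ)‖ := by
    intro x hx
    rw [xi_eq (by simp; linarith) (by norm_cast; linarith), norm_mul, norm_mul, norm_mul,
      norm_Gammaℝ_ofReal (by linarith)]
    norm_cast
    rw [Real.norm_of_nonneg (by linarith), Real.norm_of_nonneg (by linarith)]
  have h1 : ‖riemannZeta (x : ℂ)‖ ≤ 5 / 3 := by
    have := norm_add_le (riemannZeta (x : ℂ) - 1) 1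
    rw [sub_add_cancel, norm_one] at this
    linarith [hz x hx]
  have h2 : 1 / 3 ≤ ‖riemannZeta (y : ℂ)‖ := by
    have := norm_sub_le (riemannZeta (y : ℂ)) (riemannZeta (y : ℂ) - 1)
    rw [sub_sub_cancel, norm_one] at this
    linarith [hz y (by linarith)]
  have h3 : Real.Gamma (x / 2) ≤ Real.Gamma (y / 2) :=
    Real.Gamma_strictMonoOn_Ici.monotoneOn (Set.mem_Ici.2 (by linarith))
        (Set.mem_Ici.2 (by linarith)) (by linarith)
  have h4 : π ^ (-x / 2) = π ^ ((y - x) / 2) * π ^ (-y / 2) := by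
    rw [← Real.rpow_add Real.pi_pos]; congr 1; ring
  have hG := Real.Gamma_pos_of_pos (show 0 < x / 2 by linarith)
  have hp1 := Real.rpow_pos_of_pos Real.pi_pos ((y - x) / 2)
  have hp2 := Real.rpow_pos_of_pos Real.pi_pos (-y / 2)
  have hyy : 0 ≤ y * (y - 1) := by nlinarith
  have hpG : 0 ≤ π ^ (-y / 2) * Real.Gamma (y / 2) := mul_nonneg hp2.le (hG.le.trans h3)
  have hpG' : 0 ≤ π ^ ((y - x) / 2) * π ^ (-y / 2) * Real.Gamma (y / 2) := by
    rw [mul_assoc]; exact mul_nonneg hp1.le hpG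
  rw [e x hx, e y (by linarith), h4]
  calc _ ≤ y * (y - 1) * (π ^ ((y - x) / 2) * π ^ (-y / 2) * Real.Gamma (y / 2)) * (5 / 3) := by
        gcongr <;> linarith
    _ = 5 * π ^ ((y - x) / 2) * (y * (y - 1) * (π ^ (-y / 2) * Real.Gamma (y / 2)) * (1 / 3)) := by
        ring
    _ ≤ _ := by
        gcongr

open ComplexConjugate in
theorem norm_xi_half_add_symm (x y : ℝ) :
    ‖xi (1 / 2 - x + y * I)‖ = ‖xi (1 / 2 + x + y * I)‖ := by
  have : (1 / 2 - x + y * I : ℂ) = 1 - conj (1 / 2 + x + y * I : ℂ) := by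
    apply Complex.ext
    · simp only [add_re, sub_re, one_re, mul_re, conj_re, ofReal_re, I_re, ofReal_im, I_im]; norm_num; ring
    · simp
  rw [this, xi_one_sub, xi_conj, RCLike.norm_conj]

theorem RiemannHypothesis.norm_xi_sub_le_norm_xi_add (hRH : RiemannHypothesis) {a : ℝ}
    (ha : 0 < a) {z : ℂ} (hz : 0 ≤ z.re) : ‖xi (1 / 2 + z - a)‖ ≤ ‖xi (1 / 2 + z + a)‖ := by
  obtain ⟨C, hC0, hC⟩ := exists_norm_xi_le
  obtain ⟨K, hK0, hK⟩ := hRH.exists_exp_le_norm_xi ha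
  have hne : ∀ z : ℂ, 0 ≤ z.re → xi (1 / 2 + z + a) ≠ 0 := fun z hz =>
    hRH.xi_ne_zero (by simp; linarith)
  have key : ‖xi (1 / 2 + z - a) / xi (1 / 2 + z + a)‖ ≤ 1 := by
    refine PhragmenLindelof.right_half_plane_of_bounded_on_real
      (f := fun z : ℂ => xi (1 / 2 + z - a) / xi (1 / 2 + z + a)) ?_ ?_ ?_ ?_ hz
    · have hcl : closure {z : ℂ | 0 < z.re} = {z : ℂ | 0 ≤ z.re} := Complex.closure_setOfPred_lt_re 0
      refine DifferentiableOn.diffContOnCl fun z hz => ?_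
      rw [hcl] at hz
      have h1 : DifferentiableAt ℂ (fun z : ℂ => xi (1 / 2 + z - a)) z :=
        (differentiable_xi _).comp z (by fun_prop)
      have h2 : DifferentiableAt ℂ (fun z : ℂ => xi (1 / 2 + z + a)) z :=
        (differentiable_xi _).comp z (by fun_prop)
      exact (h1.div h2 (hne z hz)).differentiableWithinAt
    · refine ⟨3 / 2, by norm_num, 3 * (C + K), ?_⟩
      refine Asymptotics.IsBigO.of_bound
        (Real.exp ((C + K) * (2 * (21 + a)) ^ (3 / 2 : ℝ))) ?_
      refine Filter.eventually_inf_principal.2 (Filter.Eventually.of_forall fun w hw => ?_)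
      have hw : 0 < w.re := hw
      have hA : ‖(1 / 2 : ℂ)‖ = 1 / 2 := by norm_num
      have hA' : ‖(a : ℂ)‖ = a := by rw [Complex.norm_real, Real.norm_of_nonneg ha.le]
      have hn : ‖1 / 2 + w - a‖ ≤ 1 / 2 + ‖w‖ + a := by
        have := norm_sub_le (1 / 2 + w) (a : ℂ)
        have := norm_add_le (1 / 2 : ℂ) w
        linarith
      have hd : ‖1 / 2 + w + a‖ ≤ 1 / 2 + ‖w‖ + a := by
        have := norm_add_le (1 / 2 + w) (a : ℂ)
        have := norm_add_le (1 / 2 : ℂ) w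
        linarith
      have hw0 := norm_nonneg w
      have hW := two_add_rpow_le (r := ‖w‖) (A := 21 + a) hw0 (by linarith)
      have h1 : ‖xi (1 / 2 + w - a)‖ ≤ Real.exp (C * (21 + a + ‖w‖) ^ (3 / 2 : ℝ)) := by
        refine (hC _).trans (Real.exp_le_exp.2 ?_)
        gcongr ?_ * ?_
        exact Real.rpow_le_rpow (by positivity) (by linarith) (by norm_num)
      have h2 : Real.exp (-(K * (21 + a + ‖w‖) ^ (3 / 2 : ℝ))) ≤ ‖xi (1 / 2 + w + a)‖ := by
        refine le_trans (Real.exp_le_exp.2 ?_) (hK (1 / 2 + w + a) (by simp; linarith))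
        have : (20 + ‖1 / 2 + w + a‖) ^ (3 / 2 : ℝ) ≤ (21 + a + ‖w‖) ^ (3 / 2 : ℝ) :=
          Real.rpow_le_rpow (by positivity) (by linarith) (by norm_num)
        nlinarith
      rw [norm_div, Real.norm_of_nonneg (Real.exp_nonneg _), ← Real.exp_add]
      calc _ ≤ Real.exp (C * (21 + a + ‖w‖) ^ (3 / 2 : ℝ)) /
            Real.exp (-(K * (21 + a + ‖w‖) ^ (3 / 2 : ℝ))) := by gcongr
        _ = Real.exp ((C + K) * (21 + a + ‖w‖) ^ (3 / 2 : ℝ)) := by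
            rw [← Real.exp_sub]; ring_nf
        _ ≤ _ := by
            apply Real.exp_le_exp.2
            nlinarith
    · refine Filter.isBoundedUnder_of_eventually_le (a := 5 * π ^ a) ?_
      filter_upwards [Filter.eventually_ge_atTop (a + 4)] with x hx
      have e1 : (1 / 2 + (x : ℂ) - a) = ((1 / 2 + x - a : ℝ) : ℂ) := by push_cast; ring
      have e2 : (1 / 2 + (x : ℂ) + a) = ((1 / 2 + x + a : ℝ) : ℂ) := by push_cast; ring
      rw [norm_div, div_le_iff₀ (norm_pos_iff.2 (hne _ (by simp; linarith))), e1, e2]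
      have := norm_xi_ofReal_le (x := 1 / 2 + x - a) (y := 1 / 2 + x + a) (by linarith)
        (by linarith)
      rwa [show (1 / 2 + x + a - (1 / 2 + x - a)) / 2 = a by ring] at this
    · intro y
      have h1 := norm_xi_half_add_symm a y
      rw [norm_div, show (1 / 2 + (y : ℂ) * I - a) = 1 / 2 - a + y * I by ring,
        show (1 / 2 + (y : ℂ) * I + a) = 1 / 2 + a + y * I by ring, h1]
      exact div_self_le_one _
  rw [norm_div] at key
  exact (div_le_one (norm_pos_iff.2 (hne z hz))).1 key

theorem RiemannHypothesis.norm_xi_mono (hRH : RiemannHypothesis) {s : ℂ} (hs : 1 / 2 ≤ s.re)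
    {h : ℝ} (hh : 0 ≤ h) : ‖xi s‖ ≤ ‖xi (s + h)‖ := by
  rcases hh.eq_or_lt with rfl | hh
  · simp
  · have := hRH.norm_xi_sub_le_norm_xi_add (a := h / 2) (by linarith) (z := s - 1 / 2 + h / 2)
      (by simp; linarith)
    convert this using 3 <;> push_cast <;> ring_nf

theorem norm_Gammaℝ_add_le {s : ℂ} (hs : 0 < s.re) (hs4 : s.re ≤ 4) (him : 0 ≤ s.im) {h : ℝ}
    (h0 : 0 ≤ h) (h1 : h ≤ 1) :
    ‖Gammaℝ (s + h)‖ ≤ ‖Gammaℝ s‖ * Real.exp (h * (Real.log (s.im + 4) / 2)) := by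
  rw [Gammaℝ_def, Gammaℝ_def, norm_mul, norm_mul, Complex.norm_cpow_eq_rpow_re_of_pos Real.pi_pos,
    Complex.norm_cpow_eq_rpow_re_of_pos Real.pi_pos]
  have e1 : s / 2 = ((s.re / 2 : ℝ) : ℂ) + ((s.im / 2 : ℝ) : ℂ) * I := by
    apply Complex.ext <;> simp
  have e2 : (s + h) / 2 = ((s.re / 2 + h / 2 : ℝ) : ℂ) + ((s.im / 2 : ℝ) : ℂ) * I := by
    apply Complex.ext <;> simp
    ring
  have hG := norm_Gamma_add_le (x := s.re / 2) (y := s.im / 2) (h := h / 2) (by linarith)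
    (by linarith) (by linarith)
  rw [← e1, ← e2, abs_of_nonneg (by linarith)] at hG
  have hp : π ^ (-(s + h) / 2).re ≤ π ^ (-s / 2).re := by
    apply Real.rpow_le_rpow_of_exponent_le (by linarith [Real.pi_gt_three])
    simp; linarith
  have hb : (s.re / 2 + 1 + 2 * (s.im / 2)) ^ (h / 2) ≤
      Real.exp (h * (Real.log (s.im + 4) / 2)) := by
    have : (s.re / 2 + 1 + 2 * (s.im / 2)) ^ (h / 2) ≤ (s.im + 4) ^ (h / 2) :=
      Real.rpow_le_rpow (by linarith) (by linarith) (by linarith)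
    refine this.trans (le_of_eq ?_)
    rw [Real.rpow_def_of_pos (by linarith)]
    congr 1; ring
  have hπ := Real.rpow_nonneg Real.pi_pos.le (-s / 2).re
  calc _ ≤ π ^ (-s / 2).re * (‖Complex.Gamma (s / 2)‖ *
        Real.exp (h * (Real.log (s.im + 4) / 2))) := by
        gcongr
        exact hG.trans (by gcongr)
    _ = _ := by ring

theorem RiemannHypothesis.norm_zeta_le_mul_exp (hRH : RiemannHypothesis) {s : ℂ}
    (hs : 1 / 2 < s.re) (hs4 : s.re ≤ 4) (him : 1 ≤ s.im) {h : ℝ} (h0 : 0 ≤ h) (h1 : h ≤ 1) :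
    ‖riemannZeta s‖ ≤
      ‖riemannZeta (s + h)‖ * Real.exp (h * (2 + Real.log (s.im + 4) / 2)) := by
  have hne : s ≠ 1 := by rintro rfl; norm_num at him
  have hne' : s + h ≠ 1 := by
    intro e
    have := congrArg Complex.im e
    simp at this
    linarith
  have hm := hRH.norm_xi_mono hs.le h0
  rw [xi_eq (by linarith) hne, xi_eq (by simp; linarith) hne', norm_mul, norm_mul, norm_mul,
    norm_mul, norm_mul, norm_mul] at hm
  have hG := norm_Gammaℝ_add_le (s := s) (by linarith) hs4 (by linarith) h0 h1
  have aux : ∀ w : ℂ, w.im = s.im → ‖w + h‖ ≤ ‖w‖ * Real.exp h := by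
    intro w hw
    have h2 := norm_add_le w (h : ℂ)
    rw [Complex.norm_real, Real.norm_of_nonneg h0] at h2
    have h3 := (le_abs_self _).trans (Complex.abs_im_le_norm w)
    have h4 := Real.add_one_le_exp h
    nlinarith [norm_nonneg w]
  have e1 := aux s rfl
  have e2 := aux (s - 1) (by simp)
  rw [show s - 1 + (h : ℂ) = s + h - 1 by ring] at e2
  have p1 : 0 < ‖s‖ := norm_pos_iff.2 (by rintro rfl; norm_num at him)
  have p2 : 0 < ‖s - 1‖ := norm_pos_iff.2 (sub_ne_zero.2 hne)
  have p3 : 0 < ‖Gammaℝ s‖ := norm_pos_iff.2 (Gammaℝ_ne_zero_of_re_pos (by linarith))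
  have p : 0 < ‖s‖ * ‖s - 1‖ * ‖Gammaℝ s‖ := by positivity
  refine le_of_mul_le_mul_left (hm.trans ?_) p
  calc _ ≤ (‖s‖ * Real.exp h) * (‖s - 1‖ * Real.exp h) * (‖Gammaℝ s‖ *
        Real.exp (h * (Real.log (s.im + 4) / 2))) * ‖riemannZeta (s + h)‖ := by gcongr
    _ = _ := by
        rw [show h * (2 + Real.log (s.im + 4) / 2) =
          h + h + h * (Real.log (s.im + 4) / 2) by ring, Real.exp_add, Real.exp_add]
        ring

theorem RiemannHypothesis.neg_le_re_deriv_zeta_div_zeta (hRH : RiemannHypothesis) {s : ℂ}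
    (hs : 1 / 2 < s.re) (hs4 : s.re ≤ 4) (him : 1 ≤ s.im) :
    -(2 + Real.log (s.im + 4) / 2) ≤ (deriv riemannZeta s / riemannZeta s).re := by
  set K := 2 + Real.log (s.im + 4) / 2 with hK
  have hne : s ≠ 1 := by rintro rfl; norm_num at him
  have hz := hRH.ne_zero hs
  have hd1 : HasDerivAt (fun z : ℂ => Complex.log (riemannZeta (s + z) / riemannZeta s))
      (deriv riemannZeta s / riemannZeta s) ((0 : ℝ) : ℂ) := by
    have h0 : HasDerivAt riemannZeta (deriv riemannZeta s) (s + ((0 : ℝ) : ℂ)) := by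
      simpa using (differentiableAt_riemannZeta hne).hasDerivAt
    have h1 := ((h0.comp_const_add s ((0 : ℝ) : ℂ)).div_const (riemannZeta s)).clog
      (by simp [hz])
    simpa [hz] using h1
  have hd2 := hd1.real_of_complex
  have hd3 := hd2.add ((hasDerivAt_id (0 : ℝ)).mul_const K)
  have hslope := hd3.hasDerivWithinAt (s := Set.Ioi 0)
  rw [hasDerivWithinAt_iff_tendsto_slope' (by simp)] at hslope
  have hnn : 0 ≤ (deriv riemannZeta s / riemannZeta s).re + 1 * K := by
    refine ge_of_tendsto hslope ?_
    filter_upwards [Ioo_mem_nhdsGT (show (0 : ℝ) < 1 by norm_num)] with h hh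
    rw [slope_def_field]
    refine div_nonneg ?_ (by linarith [hh.1])
    have hb := hRH.norm_zeta_le_mul_exp hs hs4 him hh.1.le hh.2.le
    have hzh : 0 < ‖riemannZeta (s + h)‖ :=
      norm_pos_iff.2 (hRH.ne_zero (by simp; linarith [hh.1]))
    have hl := Real.log_le_log (norm_pos_iff.2 hz) hb
    rw [Real.log_mul hzh.ne' (Real.exp_pos _).ne', Real.log_exp, ← hK] at hl
    simp only [Pi.add_apply, Complex.log_re, id, norm_div, Complex.ofReal_zero, add_zero]
    rw [Real.log_div hzh.ne' (norm_pos_iff.2 hz).ne', div_self (norm_pos_iff.2 hz).ne', Real.log_one]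
    linarith
  linarith

theorem RiemannHypothesis.norm_deriv_zeta_div_zeta_le (hRH : RiemannHypothesis) {s : ℂ}
    (hs : 1 / 2 < s.re) (hs2 : s.re ≤ 2) (him : 3 ≤ s.im) :
    ‖deriv riemannZeta s / riemannZeta s‖ ≤
      (24 + 2 * Real.log (s.im + 6)) / (s.re - 1 / 2) := by
  set c : ℂ := ((2 : ℝ) : ℂ) + (s.im : ℂ) * I with hc
  have hcre : c.re = 2 := by simp [hc]
  have hcim : c.im = s.im := by simp [hc]
  have hl0 : 0 ≤ Real.log (s.im + 6) := Real.log_nonneg (by linarith)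
  have hrange : ∀ z ∈ Metric.ball (0 : ℂ) (3 / 2),
      1 / 2 < (c + z).re ∧ (c + z).re ≤ 4 ∧ 1 ≤ (c + z).im ∧ (c + z).im ≤ s.im + 2 := by
    intro z hz
    rw [mem_ball_zero_iff] at hz
    have h1 := abs_le.1 (Complex.abs_re_le_norm z)
    have h2 := abs_le.1 (Complex.abs_im_le_norm z)
    simp only [add_re, add_im, hcre, hcim]
    refine ⟨?_, ?_, ?_, ?_⟩ <;> linarith
  have hsc : ‖s - c‖ = 2 - s.re := by
    have : s - c = ((s.re - 2 : ℝ) : ℂ) := by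
      apply Complex.ext <;> simp [hcre, hcim]
    rw [this, Complex.norm_real, Real.norm_eq_abs, abs_of_nonpos (by linarith)]
    ring
  have hbc := Complex.borelCaratheodory (M := 2 + Real.log (s.im + 6) / 2)
    (f := fun z => -(deriv riemannZeta (c + z) / riemannZeta (c + z))) (R := 3 / 2)
    (z := s - c) (by linarith) ?_ ?_ (by norm_num) (by
      rw [mem_ball_zero_iff, hsc]; linarith)
  · simp only [add_sub_cancel, add_zero, norm_neg, hsc] at hbc
    have h6 := _root_.norm_deriv_zeta_div_zeta_le (δ := 1) one_pos le_rfl (s := c)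
      (by rw [hcre]; norm_num)
    rw [hcre] at h6
    norm_num at h6
    rw [← norm_div] at h6
    refine hbc.trans ?_
    rw [← add_div, show 3 / 2 - (2 - s.re) = s.re - 1 / 2 by ring]
    refine div_le_div_of_nonneg_right ?_ (by linarith)
    nlinarith [norm_nonneg (deriv riemannZeta c / riemannZeta c)]
  · intro z hz
    obtain ⟨h1, h2, h3, -⟩ := hrange z hz
    have hne : c + z ≠ 1 := by
      intro h; rw [h] at h3; norm_num at h3
    have hζ : DifferentiableAt ℂ riemannZeta (c + z) := differentiableAt_riemannZeta hne
    have hζ' : DifferentiableAt ℂ (deriv riemannZeta) (c + z) := by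
      have : DifferentiableOn ℂ riemannZeta {1}ᶜ := differentiableOn_riemannZeta
      exact (this.deriv isOpen_compl_singleton).differentiableAt
        (isOpen_compl_singleton.mem_nhds hne)
    have ha : DifferentiableAt ℂ (fun z => c + z) z := by fun_prop
    exact ((hζ'.comp z ha).div (hζ.comp z ha) (hRH.ne_zero h1)).neg.differentiableWithinAt
  · intro z hz
    obtain ⟨h1, h2, h3, h4⟩ := hrange z hz
    have h5 := hRH.neg_le_re_deriv_zeta_div_zeta h1 h2 h3
    have h6 : Real.log ((c + z).im + 4) ≤ Real.log (s.im + 6) :=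
      Real.log_le_log (by linarith) (by linarith)
    show (-(deriv riemannZeta (c + z) / riemannZeta (c + z))).re ≤ _
    rw [neg_re]
    linarith

/-! ### A pair of kernels adding up to the Fejér kernel -/

namespace FejerPair

/-- The function `sin (π z) / π`. -/
noncomputable def sinPi (z : ℂ) : ℂ := Complex.sin (π * z) / π

/-- The entire function `sin (π z) / (π z)`. -/
noncomputable def sincPi : ℂ → ℂ := dslope sinPi 0

/-- The shifted trigamma series `∑ 1 / (z + 1 + n) ^ 2`. -/
noncomputable def trigammaSucc (z : ℂ) : ℂ := ∑' n : ℕ, 1 / (z + 1 + n) ^ 2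

/-- The first kernel of the pair. -/
noncomputable def kerP (z : ℂ) : ℂ := 2 * z * sincPi z ^ 2 - 2 * sinPi z ^ 2 * trigammaSucc z

/-- The second kernel of the pair. -/
noncomputable def kerQ (z : ℂ) : ℂ := 2 * sincPi z ^ 2 - kerP z

theorem differentiable_sinPi : Differentiable ℂ sinPi := by
  unfold sinPi; fun_prop

theorem sinPi_zero : sinPi 0 = 0 := by simp [sinPi]

theorem mul_sincPi (z : ℂ) : z * sincPi z = sinPi z := by
  have := sub_smul_dslope sinPi 0 z
  simpa [sincPi, sinPi_zero] using this

theorem sincPi_of_ne {z : ℂ} (hz : z ≠ 0) : sincPi z = sinPi z / z := by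
  rw [← mul_sincPi, mul_div_cancel_left₀ _ hz]

theorem sincPi_zero : sincPi 0 = 1 := by
  have h : HasDerivAt sinPi 1 0 := by
    have h1 : HasDerivAt (fun z : ℂ => (π : ℂ) * z) (π : ℂ) 0 := by
      simpa using (hasDerivAt_id (0 : ℂ)).const_mul (π : ℂ)
    have h2 := (h1.csin).div_const (π : ℂ)
    have hpi : (π : ℂ) ≠ 0 := by exact_mod_cast Real.pi_ne_zero
    refine (h2.congr_deriv ?_ : HasDerivAt sinPi 1 0)
    simp [hpi]
  rw [sincPi, dslope_same, h.deriv]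

theorem differentiable_sincPi : Differentiable ℂ sincPi := by
  rw [← differentiableOn_univ]
  exact (Complex.differentiableOn_dslope Filter.univ_mem).2 differentiable_sinPi.differentiableOn

theorem sinPi_neg (z : ℂ) : sinPi (-z) = -sinPi z := by
  simp [sinPi, neg_div]

theorem sincPi_neg (z : ℂ) : sincPi (-z) = sincPi z := by
  rcases eq_or_ne z 0 with rfl | hz
  · simp
  · rw [sincPi_of_ne (neg_ne_zero.2 hz), sincPi_of_ne hz, sinPi_neg, neg_div_neg_eq]

theorem sinPi_conj (z : ℂ) : sinPi (starRingEnd ℂ z) = starRingEnd ℂ (sinPi z) := by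
  simp only [sinPi, map_div₀, Complex.conj_ofReal, ← Complex.sin_conj, map_mul]

theorem sincPi_conj (z : ℂ) : sincPi (starRingEnd ℂ z) = starRingEnd ℂ (sincPi z) := by
  rcases eq_or_ne z 0 with rfl | hz
  · simp [sincPi_zero]
  · have : starRingEnd ℂ z ≠ 0 := by simpa using hz
    rw [sincPi_of_ne this, sincPi_of_ne hz, sinPi_conj, map_div₀]

theorem trigammaSucc_conj (z : ℂ) :
    trigammaSucc (starRingEnd ℂ z) = starRingEnd ℂ (trigammaSucc z) := by
  rw [trigammaSucc, trigammaSucc, Complex.conj_tsum]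
  simp

theorem kerP_conj (z : ℂ) : kerP (starRingEnd ℂ z) = starRingEnd ℂ (kerP z) := by
  have h2 : starRingEnd ℂ 2 = 2 := Complex.conj_ofNat 2
  simp [kerP, sincPi_conj, sinPi_conj, trigammaSucc_conj, h2]

theorem norm_one_div_sq_le {z : ℂ} (hz : -(1 / 2) < z.re) (n : ℕ) :
    ‖1 / (z + 1 + n) ^ 2‖ ≤ 4 * (1 / ((n + 1 : ℕ) : ℝ) ^ 2) := by
  have h1 : ((n : ℝ) + 1) / 2 ≤ ‖z + 1 + n‖ := by
    have := Complex.re_le_norm (z + 1 + n)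
    simp only [add_re, one_re, natCast_re] at this
    have hn : (0 : ℝ) ≤ n := n.cast_nonneg
    linarith
  have hn : (0 : ℝ) < (n : ℝ) + 1 := by positivity
  rw [norm_div, norm_one, norm_pow]
  push_cast
  calc 1 / ‖z + 1 + n‖ ^ 2 ≤ 1 / (((n : ℝ) + 1) / 2) ^ 2 := by gcongr
    _ = _ := by field_simp; norm_num

theorem summable_four_div_sq : Summable fun n : ℕ => 4 * (1 / ((n + 1 : ℕ) : ℝ) ^ 2) :=
  ((summable_nat_add_iff 1).2 (Real.summable_one_div_nat_pow.2 one_lt_two)).mul_left 4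

theorem summable_trigammaSucc {z : ℂ} (hz : -(1 / 2) < z.re) :
    Summable fun n : ℕ => 1 / (z + 1 + n) ^ 2 :=
  Summable.of_norm_bounded summable_four_div_sq (norm_one_div_sq_le hz)

theorem isOpen_neg_half_lt_re : IsOpen {z : ℂ | -(1 / 2) < z.re} :=
  isOpen_lt continuous_const Complex.continuous_re

theorem add_ne_zero_of_re {z : ℂ} (hz : -(1 / 2) < z.re) (n : ℕ) : z + 1 + n ≠ 0 := by
  intro h
  have h1 := congrArg Complex.re h
  simp only [add_re, one_re, natCast_re, zero_re] at h1
  have hn : (0 : ℝ) ≤ n := n.cast_nonneg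
  linarith

theorem differentiableOn_trigammaSucc :
    DifferentiableOn ℂ trigammaSucc {z | -(1 / 2) < z.re} := by
  refine differentiableOn_tsum_of_summable_norm summable_four_div_sq (fun n z hz => ?_)
    isOpen_neg_half_lt_re (fun n z hz => norm_one_div_sq_le hz n)
  have h := add_ne_zero_of_re hz n
  have : DifferentiableAt ℂ (fun z : ℂ => 1 / (z + 1 + n) ^ 2) z := by
    refine DifferentiableAt.div (by fun_prop) (by fun_prop) (pow_ne_zero 2 h)
  exact this.differentiableWithinAt

theorem differentiableOn_kerP : DifferentiableOn ℂ kerP {z | -(1 / 2) < z.re} := by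
  have h1 := differentiable_sincPi.differentiableOn (s := {z | -(1 / 2) < z.re})
  have h2 := differentiable_sinPi.differentiableOn (s := {z | -(1 / 2) < z.re})
  exact (((differentiableOn_id.const_mul 2).mul (h1.pow 2))).sub
    (((h2.pow 2).const_mul 2).mul differentiableOn_trigammaSucc)

theorem differentiableOn_kerQ : DifferentiableOn ℂ kerQ {z | -(1 / 2) < z.re} := by
  have h1 := differentiable_sincPi.differentiableOn (s := {z | -(1 / 2) < z.re})
  exact ((h1.pow 2).const_mul 2).sub differentiableOn_kerP

theorem kerP_zero : kerP 0 = 0 := by simp [kerP, sinPi_zero]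

theorem kerQ_zero : kerQ 0 = 2 := by simp [kerQ, kerP_zero, sincPi_zero]

theorem norm_le_norm_add_nat {z : ℂ} (hz : 0 ≤ z.re) (n : ℕ) : ‖z‖ ≤ ‖z + n‖ := by
  have hn : (0 : ℝ) ≤ n := n.cast_nonneg
  rw [← sq_le_sq₀ (norm_nonneg _) (norm_nonneg _), ← Complex.normSq_eq_norm_sq,
    ← Complex.normSq_eq_norm_sq, Complex.normSq_apply, Complex.normSq_apply]
  simp only [add_re, add_im, natCast_re, natCast_im, add_zero]
  nlinarith

theorem norm_telescope_term_le {z : ℂ} (hz : 0 ≤ z.re) (h0 : z ≠ 0) (n : ℕ) :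
    ‖1 / ((z + n) * (z + 1 + n) ^ 2)‖ ≤ 1 / ‖z‖ * (1 / ((n + 1 : ℕ) : ℝ) ^ 2) := by
  have hn : (0 : ℝ) ≤ n := n.cast_nonneg
  have h1 : (n : ℝ) + 1 ≤ ‖z + 1 + n‖ := by
    have := Complex.re_le_norm (z + 1 + n)
    simp only [add_re, one_re, natCast_re] at this
    linarith
  have h2 := norm_le_norm_add_nat hz n
  have h3 := norm_pos_iff.2 h0
  rw [norm_div, norm_one, norm_mul, norm_pow, one_div_mul_one_div]
  push_cast
  gcongr

theorem summable_telescope {z : ℂ} (hz : 0 ≤ z.re) (h0 : z ≠ 0) :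
    Summable fun n : ℕ => 1 / ((z + n) * (z + 1 + n) ^ 2) :=
  Summable.of_norm_bounded
    (((summable_nat_add_iff 1).2 (Real.summable_one_div_nat_pow.2 one_lt_two)).mul_left _)
    (norm_telescope_term_le hz h0)

theorem add_nat_ne_zero {z : ℂ} (hz : 0 ≤ z.re) (h0 : z ≠ 0) (n : ℕ) : z + n ≠ 0 :=
  norm_pos_iff.1 ((norm_pos_iff.2 h0).trans_le (norm_le_norm_add_nat hz n))

theorem inv_sub_trigammaSucc {z : ℂ} (hz : 0 ≤ z.re) (h0 : z ≠ 0) :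
    1 / z - trigammaSucc z = ∑' n : ℕ, 1 / ((z + n) * (z + 1 + n) ^ 2) := by
  have hz' : -(1 / 2) < z.re := by linarith
  have hs1 := summable_telescope hz h0
  have hs2 := summable_trigammaSucc hz'
  have hsum := hs1.add hs2
  have hterm : ∀ n : ℕ, 1 / ((z + n) * (z + 1 + n) ^ 2) + 1 / (z + 1 + n) ^ 2 =
      1 / (z + n) - 1 / (z + (n + 1 : ℕ)) := by
    intro n
    have h1 := add_nat_ne_zero hz h0 n
    have h2 := add_ne_zero_of_re hz' n
    have h3 : z + ((n + 1 : ℕ) : ℂ) = z + 1 + n := by push_cast; ring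
    rw [h3]
    field_simp
    ring
  have hlim : Filter.Tendsto (fun N : ℕ => ∑ n ∈ Finset.range N,
      (1 / ((z + n) * (z + 1 + n) ^ 2) + 1 / (z + 1 + n) ^ 2)) Filter.atTop (nhds (1 / z)) := by
    simp_rw [hterm, Finset.sum_range_sub' (fun n : ℕ => 1 / (z + (n : ℂ)))]
    have : Filter.Tendsto (fun N : ℕ => 1 / (z + (N : ℂ))) Filter.atTop (nhds 0) := by
      simp_rw [one_div]
      refine Filter.Tendsto.comp Filter.tendsto_inv₀_cobounded ?_
      exact (tendsto_const_add_cobounded z).comp tendsto_natCast_atTop_cobounded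
    simpa using this.const_sub (1 / z)
  have := tendsto_nhds_unique hlim hsum.hasSum.tendsto_sum_nat
  rw [hs1.tsum_add hs2] at this
  rw [this, trigammaSucc, add_sub_cancel_right]

theorem kerP_eq {z : ℂ} (h0 : z ≠ 0) :
    kerP z = 2 * sinPi z ^ 2 * (1 / z - trigammaSucc z) := by
  rw [kerP, ← mul_sincPi]
  field_simp

theorem norm_inv_sub_trigammaSucc_le {z : ℂ} (hz : 0 ≤ z.re) (h0 : z ≠ 0) :
    ‖1 / z - trigammaSucc z‖ ≤ 2 / ‖z‖ := by
  rw [inv_sub_trigammaSucc hz h0]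
  have hs := (summable_nat_add_iff 1).2 (Real.summable_one_div_nat_pow.2 one_lt_two)
  refine (tsum_of_norm_bounded (hs.mul_left (1 / ‖z‖)).hasSum
    (norm_telescope_term_le hz h0)).trans ?_
  rw [tsum_mul_left]
  have h2 : ∑' n : ℕ, 1 / ((n + 1 : ℕ) : ℝ) ^ 2 = π ^ 2 / 6 := by
    have h := hasSum_zeta_two
    rw [← h.tsum_eq, h.summable.tsum_eq_zero_add]
    simp
  rw [h2, div_eq_mul_one_div 2, mul_comm]
  gcongr
  nlinarith [Real.pi_gt_three, Real.pi_lt_d2]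

theorem norm_sinPi_sq_le (z : ℂ) : ‖sinPi z ^ 2‖ ≤ Real.exp (2 * π * |z.im|) / π ^ 2 := by
  have h := _root_.norm_sin_le_exp_abs_im (π * z)
  have him : |((π : ℂ) * z).im| = π * |z.im| := by
    simp [abs_mul, abs_of_pos Real.pi_pos]
  rw [him] at h
  rw [sinPi, div_pow, norm_div, norm_pow, norm_pow, Complex.norm_real, Real.norm_eq_abs,
    abs_of_pos Real.pi_pos]
  gcongr
  calc ‖Complex.sin (π * z)‖ ^ 2 ≤ Real.exp (π * |z.im|) ^ 2 := by gcongr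
    _ = _ := by rw [← Real.exp_nat_mul]; congr 1; push_cast; ring

theorem norm_kerP_le {z : ℂ} (hz : 0 ≤ z.re) (h1 : 1 ≤ ‖z‖) :
    ‖kerP z‖ ≤ Real.exp (2 * π * |z.im|) / ‖z‖ := by
  have h0 : z ≠ 0 := norm_pos_iff.1 (by linarith)
  rw [kerP_eq h0, norm_mul, norm_mul]
  have h2 := norm_sinPi_sq_le z
  have h3 := norm_inv_sub_trigammaSucc_le hz h0
  have hp := Real.pi_gt_three
  calc ‖(2 : ℂ)‖ * ‖sinPi z ^ 2‖ * ‖1 / z - trigammaSucc z‖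
      ≤ 2 * (Real.exp (2 * π * |z.im|) / π ^ 2) * (2 / ‖z‖) := by
        rw [Complex.norm_ofNat]; gcongr
    _ = (4 / π ^ 2) * (Real.exp (2 * π * |z.im|) / ‖z‖) := by ring
    _ ≤ 1 * (Real.exp (2 * π * |z.im|) / ‖z‖) := by
        gcongr
        rw [div_le_one (by positivity)]; nlinarith
    _ = _ := one_mul _

theorem kerQ_eq {z : ℂ} (h0 : z ≠ 0) :
    kerQ z = 2 * sinPi z ^ 2 * (1 / z ^ 2 - (1 / z - trigammaSucc z)) := by
  rw [kerQ, kerP_eq h0, sincPi_of_ne h0]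
  ring

theorem norm_kerQ_le {z : ℂ} (hz : 0 ≤ z.re) (h1 : 1 ≤ ‖z‖) :
    ‖kerQ z‖ ≤ Real.exp (2 * π * |z.im|) / ‖z‖ := by
  have h0 : z ≠ 0 := norm_pos_iff.1 (by linarith)
  rw [kerQ_eq h0, norm_mul, norm_mul]
  have h2 := norm_sinPi_sq_le z
  have h3 := norm_inv_sub_trigammaSucc_le hz h0
  have h4 : ‖1 / z ^ 2‖ ≤ 1 / ‖z‖ := by
    rw [norm_div, norm_one, norm_pow]
    gcongr
    exact le_self_pow₀ h1 two_ne_zero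
  have h5 : ‖1 / z ^ 2 - (1 / z - trigammaSucc z)‖ ≤ 3 / ‖z‖ := by
    refine (norm_sub_le _ _).trans ((add_le_add h4 h3).trans (le_of_eq ?_))
    rw [← add_div]; norm_num
  have hp := Real.pi_gt_three
  calc ‖(2 : ℂ)‖ * ‖sinPi z ^ 2‖ * ‖1 / z ^ 2 - (1 / z - trigammaSucc z)‖
      ≤ 2 * (Real.exp (2 * π * |z.im|) / π ^ 2) * (3 / ‖z‖) := by
        rw [Complex.norm_ofNat]; gcongr
    _ = (6 / π ^ 2) * (Real.exp (2 * π * |z.im|) / ‖z‖) := by ring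
    _ ≤ 1 * (Real.exp (2 * π * |z.im|) / ‖z‖) := by
        gcongr
        rw [div_le_one (by positivity)]; nlinarith
    _ = _ := one_mul _

theorem kerP_add_kerQ (z : ℂ) : kerP z + kerQ z = 2 * sincPi z ^ 2 := by
  rw [kerQ]; ring

theorem sinPi_ofReal (x : ℝ) : sinPi x = ((Real.sin (π * x) / π : ℝ) : ℂ) := by
  simp [sinPi]

/-- On the nonnegative reals both kernels are real and nonnegative. -/
theorem exists_kerP_kerQ_ofReal {x : ℝ} (hx : 0 ≤ x) :
    0 ≤ (kerP x).re ∧ (kerP x).im = 0 ∧ 0 ≤ (kerQ x).re ∧ (kerQ x).im = 0 := by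
  rcases hx.eq_or_lt with rfl | hx
  · simp [kerP_zero, kerQ_zero]
  have hx0 : (x : ℂ) ≠ 0 := by exact_mod_cast hx.ne'
  have hre : (0 : ℝ) ≤ (x : ℂ).re := by simpa using hx.le
  set d : ℝ := ∑' n : ℕ, 1 / ((x + n) * (x + 1 + n) ^ 2) with hd
  have hD : 1 / (x : ℂ) - trigammaSucc x = (d : ℂ) := by
    rw [inv_sub_trigammaSucc hre hx0, hd, Complex.ofReal_tsum]
    push_cast
    rfl
  have hnn : ∀ n : ℕ, 0 ≤ 1 / ((x + n) * (x + 1 + n) ^ 2) := fun n => by positivity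
  have hd0 : 0 ≤ d := tsum_nonneg hnn
  have hd1 : d ≤ 1 / x ^ 2 := by
    refine Real.tsum_le_of_sum_range_le hnn fun N => ?_
    calc ∑ n ∈ Finset.range N, 1 / ((x + n) * (x + 1 + n) ^ 2)
        ≤ ∑ n ∈ Finset.range N, (1 / (x + (n : ℕ)) ^ 2 - 1 / (x + (n + 1 : ℕ)) ^ 2) := by
          refine Finset.sum_le_sum fun n _ => ?_
          have h3 : x + ((n + 1 : ℕ) : ℝ) = x + 1 + n := by push_cast; ring
          have h1 : 0 < x + n := by positivity
          rw [h3, div_sub_div _ _ (by positivity) (by positivity),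
            div_le_div_iff₀ (by positivity) (by positivity)]
          have h4 : x + 1 + n = (x + n) + 1 := by ring
          rw [h4]
          generalize x + (n : ℝ) = a at h1
          have : 0 ≤ a * (a + 1) ^ 2 * (a + 1) := by positivity
          nlinarith
      _ = 1 / x ^ 2 - 1 / (x + N) ^ 2 := by
          rw [Finset.sum_range_sub' (fun n : ℕ => 1 / (x + (n : ℝ)) ^ 2)]; simp
      _ ≤ 1 / x ^ 2 := by
          have : 0 ≤ 1 / (x + N) ^ 2 := by positivity
          linarith
  have hP : kerP x = ((2 * (Real.sin (π * x) / π) ^ 2 * d : ℝ) : ℂ) := by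
    rw [kerP_eq hx0, hD, sinPi_ofReal]; push_cast; ring
  have hQ : kerQ x = ((2 * (Real.sin (π * x) / π) ^ 2 * (1 / x ^ 2 - d) : ℝ) : ℂ) := by
    rw [kerQ_eq hx0, hD, sinPi_ofReal]; push_cast; ring
  rw [hP, hQ]
  refine ⟨?_, Complex.ofReal_im _, ?_, Complex.ofReal_im _⟩
  · rw [Complex.ofReal_re]; positivity
  · rw [Complex.ofReal_re]
    exact mul_nonneg (by positivity) (by linarith)

theorem sinPi_ne_zero_of_im_pos {z : ℂ} (hz : 0 < z.im) : sinPi z ≠ 0 := by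
  intro h0
  rw [sinPi, div_eq_zero_iff] at h0
  rcases h0 with h0 | h0
  · obtain ⟨k, hk⟩ := Complex.sin_eq_zero_iff.1 h0
    have := congrArg Complex.im hk
    simp [Real.pi_ne_zero, hz.ne'] at this
  · exact Real.pi_ne_zero (by exact_mod_cast h0)

theorem hasDerivAt_pi_mul_cot {z : ℂ} (hz : sinPi z ≠ 0) :
    HasDerivAt (fun x : ℂ => (π : ℂ) * Complex.cot (π * x)) (-(1 / sinPi z ^ 2)) z := by
  have hpi : (π : ℂ) ≠ 0 := by exact_mod_cast Real.pi_ne_zero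
  have hsin : Complex.sin (π * z) ≠ 0 := by
    intro h; exact hz (by rw [sinPi, h, zero_div])
  have h1 : HasDerivAt (fun z : ℂ => (π : ℂ) * z) (π : ℂ) z := by
    simpa using (hasDerivAt_id z).const_mul (π : ℂ)
  have h2 := (h1.ccos.div h1.csin hsin).const_mul (π : ℂ)
  have heq : (fun x : ℂ => (π : ℂ) * Complex.cot (π * x)) =
      fun x : ℂ => (π : ℂ) * (Complex.cos (π * x) / Complex.sin (π * x)) := by
    ext x; rw [Complex.cot]
  rw [heq]
  refine h2.congr_deriv ?_
  have h3 := Complex.sin_sq_add_cos_sq (π * z)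
  rw [sinPi, div_pow, one_div_div, mul_div_assoc', ← neg_div,
    div_left_inj' (pow_ne_zero 2 hsin)]
  linear_combination (-(π : ℂ) ^ 2) * h3

theorem trigammaSucc_add_neg {z : ℂ} (hz : 0 < z.im) (hre : z.re = 0) :
    trigammaSucc z + trigammaSucc (-z) + 1 / z ^ 2 = 1 / sinPi z ^ 2 := by
  have hmem : z ∈ UpperHalfPlane.upperHalfPlaneSet := hz
  have h := iteratedDerivWithin_cot_pi_mul_eq_mul_tsum_div_pow le_rfl hmem
  rw [iteratedDerivWithin_one, derivWithin_of_isOpen UpperHalfPlane.isOpen_upperHalfPlaneSet hmem,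
    (hasDerivAt_pi_mul_cot (sinPi_ne_zero_of_im_pos hz)).deriv] at h
  have hr1 : -(1 / 2) < z.re := by rw [hre]; norm_num
  have hr2 : -(1 / 2) < (-z).re := by rw [neg_re, hre]; norm_num
  set f : ℤ → ℂ := fun n => 1 / (z + n) ^ (1 + 1) with hf
  have t1 : ∀ n : ℕ, f ((n + 1 : ℕ) : ℤ) = 1 / (z + 1 + n) ^ 2 := by
    intro n
    simp only [hf]
    push_cast
    rw [show z + ((n : ℂ) + 1) = z + 1 + n by ring]
  have t2 : ∀ n : ℕ, f (-((n : ℤ) + 1)) = 1 / (-z + 1 + n) ^ 2 := by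
    intro n
    simp only [hf]
    push_cast
    rw [← neg_sq (-z + 1 + n), show z + -((n : ℂ) + 1) = -(-z + 1 + n) by ring]
  have hs1 : Summable fun n : ℕ => f n :=
    (summable_nat_add_iff 1).1 ((summable_trigammaSucc hr1).congr fun n => (t1 n).symm)
  have hs2 : Summable fun n : ℕ => f (-((n : ℤ) + 1)) :=
    (summable_trigammaSucc hr2).congr fun n => (t2 n).symm
  have e1 : ∑' n : ℕ, f ((n + 1 : ℕ) : ℤ) = trigammaSucc z := tsum_congr t1
  have e2 : ∑' n : ℕ, f (-((n : ℤ) + 1)) = trigammaSucc (-z) := tsum_congr t2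
  have e0 : f ((0 : ℕ) : ℤ) = 1 / z ^ 2 := by simp [hf]
  rw [tsum_of_nat_of_neg_add_one hs1 hs2, hs1.tsum_eq_zero_add, e0, e1, e2, pow_one,
    Nat.factorial_one, Nat.cast_one] at h
  linear_combination h

theorem kerQ_neg_I_mul {y : ℝ} (hy : 0 ≤ y) :
    kerQ (-(y * I)) = 2 + starRingEnd ℂ (kerP (-(y * I))) := by
  rw [← kerP_conj]
  have hc : starRingEnd ℂ (-((y : ℂ) * I)) = y * I := by simp
  rw [hc]
  rcases hy.eq_or_lt with rfl | hy
  · simp [kerP_zero, kerQ_zero]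
  set z : ℂ := y * I with hz
  have him : 0 < z.im := by simpa [hz] using hy
  have hre : z.re = 0 := by simp [hz]
  have h0 : z ≠ 0 := by intro h; rw [h] at him; simp at him
  have h := trigammaSucc_add_neg him hre
  have hS := sinPi_ne_zero_of_im_pos him
  rw [kerQ, kerP, kerP, sincPi_neg, sinPi_neg]
  have h2 : sinPi z ^ 2 * (trigammaSucc z + trigammaSucc (-z)) = 1 - sincPi z ^ 2 := by
    rw [eq_sub_of_add_eq h, sincPi_of_ne h0]
    field_simp
  linear_combination 2 * h2

end FejerPair

/-! ### The total mass of the Fejér kernel -/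

namespace FejerPair

/-- The `k`-th Dirichlet kernel in the variable `2 * x`. -/
noncomputable def dirichletKer (k : ℕ) (x : ℝ) : ℝ :=
  1 + 2 * ∑ j ∈ Finset.range k, Real.cos (2 * (j + 1) * x)

theorem sin_mul_dirichletKer (k : ℕ) (x : ℝ) :
    Real.sin x * dirichletKer k x = Real.sin ((2 * k + 1) * x) := by
  unfold dirichletKer
  induction k with
  | zero => simp
  | succ k ih =>
    rw [Finset.sum_range_succ]
    have h1 : (2 * ((k + 1 : ℕ) : ℝ) + 1) * x = 2 * (k + 1) * x + x := by push_cast; ring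
    have h2 : (2 * (k : ℝ) + 1) * x = 2 * (k + 1) * x - x := by ring
    rw [h1, Real.sin_add]
    rw [h2, Real.sin_sub] at ih
    linear_combination ih

theorem sin_sq_mul_sum_dirichletKer (N : ℕ) (x : ℝ) :
    Real.sin x ^ 2 * ∑ k ∈ Finset.range N, dirichletKer k x = Real.sin (N * x) ^ 2 := by
  induction N with
  | zero => simp
  | succ N ih =>
    rw [Finset.sum_range_succ, mul_add, ih, sq (Real.sin x), mul_assoc, sin_mul_dirichletKer]
    have h1 : ((N + 1 : ℕ) : ℝ) * x = N * x + x := by push_cast; ring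
    have h2 : (2 * (N : ℝ) + 1) * x = N * x + (N * x + x) := by ring
    rw [h1, h2, Real.sin_add (N * x) (N * x + x), Real.sin_add (N * x) x, Real.cos_add (N * x) x]
    have h4 := Real.sin_sq_add_cos_sq x
    linear_combination (-(Real.sin (N * x) ^ 2)) * h4

theorem continuous_dirichletKer (k : ℕ) : Continuous (dirichletKer k) := by
  unfold dirichletKer; fun_prop

theorem integral_dirichletKer (k : ℕ) : ∫ x in (0 : ℝ)..π / 2, dirichletKer k x = π / 2 := by
  unfold dirichletKer
  rw [intervalIntegral.integral_add (by simp)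
    (Continuous.intervalIntegrable (by fun_prop) _ _), intervalIntegral.integral_const_mul,
    intervalIntegral.integral_finsetSum
      (fun j _ => Continuous.intervalIntegrable (by fun_prop) _ _)]
  have : ∀ j : ℕ, ∫ x in (0 : ℝ)..π / 2, Real.cos (2 * (j + 1) * x) = 0 := by
    intro j
    have hj : (2 * ((j : ℝ) + 1)) ≠ 0 := by positivity
    rw [intervalIntegral.integral_comp_mul_left (fun x => Real.cos x) hj, integral_cos]
    have h1 : 2 * ((j : ℝ) + 1) * (π / 2) = ((j + 1 : ℕ) : ℝ) * π := by push_cast; ring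
    rw [h1, Real.sin_nat_mul_pi]
    simp
  simp [this]

theorem sin_sq_le_sq_mul_sum_dirichletKer (N : ℕ) {x : ℝ} (h0 : 0 ≤ x) (h1 : x ≤ π / 2) :
    Real.sin (N * x) ^ 2 ≤ x ^ 2 * ∑ k ∈ Finset.range N, dirichletKer k x := by
  rcases h0.eq_or_lt with rfl | h0
  · simp
  have hs : 0 < Real.sin x := Real.sin_pos_of_pos_of_lt_pi h0 (by linarith [Real.pi_pos])
  have hF : 0 ≤ ∑ k ∈ Finset.range N, dirichletKer k x := by
    have h := sin_sq_mul_sum_dirichletKer N x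
    have h2 : 0 ≤ Real.sin x ^ 2 * ∑ k ∈ Finset.range N, dirichletKer k x := by
      rw [h]; positivity
    exact nonneg_of_mul_nonneg_right h2 (by positivity)
  rw [← sin_sq_mul_sum_dirichletKer]
  have := Real.sin_le h0.le
  gcongr

theorem sincPi_ofReal (u : ℝ) : sincPi u = ((Real.sinc (π * u) : ℝ) : ℂ) := by
  rcases eq_or_ne u 0 with rfl | hu
  · simp [sincPi_zero]
  · have hu' : (u : ℂ) ≠ 0 := by exact_mod_cast hu
    rw [sincPi_of_ne hu', sinPi_ofReal, Real.sinc_of_ne_zero (by positivity)]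
    push_cast
    rw [div_div]

theorem integral_sinc_sq_le_half (X : ℝ) (hX : 0 ≤ X) :
    ∫ u in (0 : ℝ)..X, 2 * Real.sinc (π * u) ^ 2 ≤ 1 := by
  obtain ⟨N, hN⟩ := exists_nat_gt (2 * X)
  have hN0 : (0 : ℝ) < N := by linarith
  have hcont : Continuous fun u : ℝ => 2 * Real.sinc (π * u) ^ 2 := by
    have := Real.continuous_sinc
    fun_prop
  have hcontD : Continuous fun u : ℝ => 2 / (N : ℝ) ^ 2 *
      ∑ k ∈ Finset.range N, dirichletKer k (π / N * u) := by
    have := continuous_dirichletKer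
    fun_prop
  calc ∫ u in (0 : ℝ)..X, 2 * Real.sinc (π * u) ^ 2
      ≤ ∫ u in (0 : ℝ)..N / 2, 2 * Real.sinc (π * u) ^ 2 := by
        refine intervalIntegral.integral_mono_interval le_rfl hX (by linarith) ?_
          (hcont.intervalIntegrable _ _)
        exact Filter.Eventually.of_forall fun u => by positivity
    _ ≤ ∫ u in (0 : ℝ)..N / 2, 2 / (N : ℝ) ^ 2 *
          ∑ k ∈ Finset.range N, dirichletKer k (π / N * u) := by
        refine intervalIntegral.integral_mono_on (by positivity) (hcont.intervalIntegrable _ _)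
          (hcontD.intervalIntegrable _ _) fun u hu => ?_
        have h0 : 0 ≤ π / N * u := mul_nonneg (by positivity) hu.1
        have h1 : π / N * u ≤ π / 2 := by
          calc π / N * u ≤ π / N * (N / 2) := by gcongr; exact hu.2
            _ = π / 2 := by field_simp
        have h := sin_sq_le_sq_mul_sum_dirichletKer N h0 h1
        rcases hu.1.eq_or_lt with h2 | h2
        · subst h2
          have hd : ∀ k : ℕ, dirichletKer k 0 = 2 * k + 1 := by
            intro k; simp [dirichletKer]; ring
          have hsum : ∑ k ∈ Finset.range N, (2 * (k : ℝ) + 1) = (N : ℝ) ^ 2 := by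
            clear * -
            induction N with
            | zero => simp
            | succ n ih => rw [Finset.sum_range_succ, ih]; push_cast; ring
          simp only [mul_zero, Real.sinc_zero, hd, hsum]
          field_simp
          simp
        · rw [Real.sinc_of_ne_zero (by positivity), div_pow]
          have h3 : (N : ℝ) * (π / N * u) = π * u := by field_simp
          rw [h3] at h
          calc 2 * (Real.sin (π * u) ^ 2 / (π * u) ^ 2)
              ≤ 2 * (((π / N * u) ^ 2 * ∑ k ∈ Finset.range N, dirichletKer k (π / N * u)) /
                (π * u) ^ 2) := by gcongr
            _ = _ := by field_simp
    _ = 1 := by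
        rw [intervalIntegral.integral_const_mul,
          intervalIntegral.integral_comp_mul_left
            (fun x => ∑ k ∈ Finset.range N, dirichletKer k x) (by positivity : π / (N : ℝ) ≠ 0),
          mul_zero, show π / (N : ℝ) * (N / 2) = π / 2 by field_simp,
          intervalIntegral.integral_finsetSum
            (fun k _ => (continuous_dirichletKer k).intervalIntegrable _ _)]
        simp only [integral_dirichletKer, Finset.sum_const, Finset.card_range, nsmul_eq_mul,
          smul_eq_mul]
        field_simp

end FejerPair

/-! ### A one-sided contour inequality -/

namespace FejerPair

theorem norm_one_sub_sq_div_le {z : ℂ} {T : ℝ} (hT : 0 < T) (h1 : |z.re| ≤ T) (h2 : |z.im| ≤ T) :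
    ‖1 - z ^ 2 / (T : ℂ) ^ 2‖ ≤ 3 := by
  have h3 : ‖z‖ ^ 2 ≤ 2 * T ^ 2 := by
    rw [← Complex.normSq_eq_norm_sq, Complex.normSq_apply, ← sq, ← sq, ← sq_abs z.re,
      ← sq_abs z.im]
    nlinarith [abs_nonneg z.re, abs_nonneg z.im]
  refine (norm_sub_le _ _).trans ?_
  rw [norm_one, norm_div, norm_pow, norm_pow, Complex.norm_real, Real.norm_eq_abs,
    abs_of_pos hT]
  have : ‖z‖ ^ 2 / T ^ 2 ≤ 2 := (div_le_iff₀ (by positivity)).2 h3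
  linarith

theorem norm_one_add_sq_div_le {T y : ℝ} (hT : 0 < T) (hy : 0 ≤ y) (hyT : y ≤ T) :
    ‖1 - ((T : ℂ) - y * I) ^ 2 / (T : ℂ) ^ 2‖ ≤ 3 * y / T := by
  have hT' : (T : ℂ) ≠ 0 := by exact_mod_cast hT.ne'
  have h : 1 - ((T : ℂ) - y * I) ^ 2 / (T : ℂ) ^ 2 =
      ((y : ℂ) * (2 * T * I + y)) / (T : ℂ) ^ 2 := by
    field_simp
    linear_combination (-(y : ℂ) ^ 2) * I_sq
  have h2 : ‖2 * (T : ℂ) * I + y‖ ≤ 3 * T := by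
    refine (norm_add_le _ _).trans ?_
    simp only [norm_mul, Complex.norm_ofNat, Complex.norm_real, Complex.norm_I,
      Real.norm_eq_abs, abs_of_pos hT, abs_of_nonneg hy]
    linarith
  rw [h, norm_div, norm_mul, norm_pow, Complex.norm_real, Complex.norm_real, Real.norm_eq_abs,
    Real.norm_eq_abs, abs_of_pos hT, abs_of_nonneg hy]
  calc y * ‖2 * (T : ℂ) * I + y‖ / T ^ 2 ≤ y * (3 * T) / T ^ 2 := by gcongr
    _ = 3 * y / T := by field_simp

theorem norm_kernel_contour_le {K φ : ℂ → ℂ} {T Y Δ M M₁ : ℝ}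
    (hK : DifferentiableOn ℂ K {z | -(1 / 2) < z.re})
    (hKb : ∀ z : ℂ, 0 ≤ z.re → 1 ≤ ‖z‖ → ‖K z‖ ≤ Real.exp (2 * π * |z.im|) / ‖z‖)
    (hY : 1 / 2 ≤ Y) (hYT : Y ≤ T) (hΔ : 0 < Δ) (hΔY : 1 ≤ Δ * Y)
    (hφ : DifferentiableOn ℂ φ (Set.Icc 0 T ×ℂ Set.Icc (-Y) 0))
    (hφM : ∀ y, 0 < y → y ≤ Y → ‖φ (T - y * I)‖ ≤ M / y)
    (hφM₁ : ∀ v, 0 ≤ v → v ≤ T → ‖φ (v - Y * I)‖ ≤ M₁) :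
    ‖(∫ v in (0 : ℝ)..T, K (Δ * v) * (1 - (v : ℂ) ^ 2 / (T : ℂ) ^ 2) * φ v) +
      I * ∫ y in (0 : ℝ)..Y, K (Δ * (-(y * I))) * (1 - (-(y * I)) ^ 2 / (T : ℂ) ^ 2) *
        φ (-(y * I))‖ ≤
      6 * M₁ * Real.exp (2 * π * (Δ * Y)) / Δ * Real.log (2 * T + 1) +
        3 * M * Y * Real.exp (2 * π * (Δ * Y)) / (Δ * T ^ 2) := by
  have hY0 : 0 < Y := by linarith
  have hT0 : 0 < T := by linarith
  have hM₁0 : 0 ≤ M₁ := (norm_nonneg _).trans (hφM₁ 0 le_rfl hT0.le)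
  set F : ℂ → ℂ := fun z => K (Δ * z) * (1 - z ^ 2 / (T : ℂ) ^ 2) * φ z with hF
  have hFd : DifferentiableOn ℂ F (Set.Icc 0 T ×ℂ Set.Icc (-Y) 0) := by
    refine DifferentiableOn.mul (DifferentiableOn.mul ?_ ?_) hφ
    · refine hK.comp (by fun_prop) fun z hz => ?_
      have h1 : 0 ≤ Δ * z.re := mul_nonneg hΔ.le hz.1.1
      simp only [Set.mem_ofPred_eq, re_ofReal_mul]
      linarith
    · fun_prop
  have hcauchy := Complex.integral_boundary_rect_eq_zero_of_differentiableOn F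
    (-(Y * I)) T (by
      have e1 : (-((Y : ℂ) * I)).re = 0 := by simp
      have e2 : (-((Y : ℂ) * I)).im = -Y := by simp
      rw [e1, e2, Complex.ofReal_re, Complex.ofReal_im, Set.uIcc_of_le hT0.le,
        Set.uIcc_of_le (by linarith)]
      exact hFd)
  have e1 : (-((Y : ℂ) * I)).re = 0 := by simp
  have e2 : (-((Y : ℂ) * I)).im = -Y := by simp
  rw [e1, e2, Complex.ofReal_re, Complex.ofReal_im] at hcauchy
  have f1 : ∫ y in (-Y)..0, F ((T : ℂ) + y * I) = ∫ y in (0 : ℝ)..Y, F (T - y * I) := by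
    rw [← neg_zero, ← intervalIntegral.integral_comp_neg, neg_zero]
    congr 1; ext y; push_cast; ring_nf
  have f2 : ∫ y in (-Y)..0, F (((0 : ℝ) : ℂ) + y * I) = ∫ y in (0 : ℝ)..Y, F (-(y * I)) := by
    rw [← neg_zero, ← intervalIntegral.integral_comp_neg, neg_zero]
    congr 1; ext y; push_cast; ring_nf
  have f3 : ∫ v in (0 : ℝ)..T, F (v + ((0 : ℝ) : ℂ) * I) = ∫ v in (0 : ℝ)..T, F v := by
    congr 1; ext v; simp
  have f4 : ∫ v in (0 : ℝ)..T, F (v + ((-Y : ℝ) : ℂ) * I) =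
      ∫ v in (0 : ℝ)..T, F (v - Y * I) := by
    congr 1; ext v; push_cast; ring_nf
  rw [f1, f2, f3, f4, smul_eq_mul, smul_eq_mul] at hcauchy
  have hkey : (∫ v in (0 : ℝ)..T, F v) + I * ∫ y in (0 : ℝ)..Y, F (-(y * I)) =
      (∫ v in (0 : ℝ)..T, F (v - Y * I)) + I * ∫ y in (0 : ℝ)..Y, F (T - y * I) := by
    linear_combination (-1 : ℂ) * hcauchy
  have hfar : ‖∫ v in (0 : ℝ)..T, F (v - Y * I)‖ ≤
      6 * M₁ * Real.exp (2 * π * (Δ * Y)) / Δ * Real.log (2 * T + 1) := by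
    have hint : ∫ v in (0 : ℝ)..T, (v + 1 / 2)⁻¹ = Real.log (2 * T + 1) := by
      rw [intervalIntegral.integral_comp_add_right (fun x => x⁻¹),
        integral_inv_of_pos (by norm_num) (by linarith)]
      congr 1; ring
    have hcont : ContinuousOn (fun v : ℝ => 6 * M₁ * Real.exp (2 * π * (Δ * Y)) / Δ *
        (v + 1 / 2)⁻¹) (Set.uIcc 0 T) := by
      refine continuousOn_const.mul (ContinuousOn.inv₀ (by fun_prop) fun v hv => ?_)
      rw [Set.uIcc_of_le hT0.le] at hv
      linarith [hv.1]
    rw [← hint, ← intervalIntegral.integral_const_mul]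
    refine intervalIntegral.norm_integral_le_of_norm_le hT0.le
      (Filter.Eventually.of_forall fun v hv => ?_) hcont.intervalIntegrable
    have hre : ((v : ℂ) - Y * I).re = v := by simp
    have him : ((v : ℂ) - Y * I).im = -Y := by simp
    have hn : (v + 1 / 2) / 2 ≤ ‖(v : ℂ) - Y * I‖ := by
      have h1 := Complex.abs_re_le_norm ((v : ℂ) - Y * I)
      have h2 := Complex.abs_im_le_norm ((v : ℂ) - Y * I)
      rw [hre, abs_of_pos hv.1] at h1
      rw [him, abs_neg, abs_of_pos hY0] at h2
      linarith
    have hnY : Y ≤ ‖(v : ℂ) - Y * I‖ := by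
      have h2 := Complex.abs_im_le_norm ((v : ℂ) - Y * I)
      rwa [him, abs_neg, abs_of_pos hY0] at h2
    have hv0 := hv.1
    have hK1 := hKb (Δ * ((v : ℂ) - Y * I))
      (by rw [re_ofReal_mul, hre]; positivity)
      (by
        rw [norm_mul, Complex.norm_real, Real.norm_eq_abs, abs_of_pos hΔ]
        exact hΔY.trans (by gcongr))
    rw [norm_mul, Complex.norm_real, Real.norm_eq_abs, abs_of_pos hΔ, im_ofReal_mul, him,
      mul_neg, abs_neg, abs_of_pos (by positivity)] at hK1
    have hp := norm_one_sub_sq_div_le (z := (v : ℂ) - Y * I) hT0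
      (by rw [hre, abs_of_pos hv0]; exact hv.2) (by rw [him, abs_neg, abs_of_pos hY0]; exact hYT)
    have hφ1 := hφM₁ v hv0.le hv.2
    simp only [hF]
    rw [norm_mul, norm_mul]
    calc ‖K (Δ * ((v : ℂ) - Y * I))‖ * ‖1 - ((v : ℂ) - Y * I) ^ 2 / (T : ℂ) ^ 2‖ *
          ‖φ ((v : ℂ) - Y * I)‖
        ≤ (Real.exp (2 * π * (Δ * Y)) / (Δ * ‖(v : ℂ) - Y * I‖)) * 3 * M₁ := by gcongr
      _ ≤ (Real.exp (2 * π * (Δ * Y)) / (Δ * ((v + 1 / 2) / 2))) * 3 * M₁ := by gcongr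
      _ = _ := by field_simp; ring
  have htop : ‖∫ y in (0 : ℝ)..Y, F (T - y * I)‖ ≤
      3 * M * Y * Real.exp (2 * π * (Δ * Y)) / (Δ * T ^ 2) := by
    have hb : ∀ y ∈ Set.uIoc 0 Y, ‖F ((T : ℂ) - y * I)‖ ≤
        3 * M * Real.exp (2 * π * (Δ * Y)) / (Δ * T ^ 2) := by
      intro y hy
      rw [Set.uIoc_of_le hY0.le] at hy
      obtain ⟨hy0, hyY⟩ := hy
      have hre : ((T : ℂ) - y * I).re = T := by simp
      have him : ((T : ℂ) - y * I).im = -y := by simp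
      have hnT : T ≤ ‖(T : ℂ) - y * I‖ := by
        have h2 := Complex.abs_re_le_norm ((T : ℂ) - y * I)
        rwa [hre, abs_of_pos hT0] at h2
      have hK1 := hKb (Δ * ((T : ℂ) - y * I))
        (by rw [re_ofReal_mul, hre]; positivity)
        (by
          rw [norm_mul, Complex.norm_real, Real.norm_eq_abs, abs_of_pos hΔ]
          exact hΔY.trans (mul_le_mul_of_nonneg_left (hYT.trans hnT) hΔ.le))
      rw [norm_mul, Complex.norm_real, Real.norm_eq_abs, abs_of_pos hΔ, im_ofReal_mul, him,
        mul_neg, abs_neg, abs_of_pos (by positivity)] at hK1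
      have hp := norm_one_add_sq_div_le hT0 hy0.le (hyY.trans hYT)
      have hφ1 := hφM y hy0 hyY
      simp only [hF]
      rw [norm_mul, norm_mul]
      have hMy : 0 ≤ M / y := (norm_nonneg _).trans hφ1
      calc ‖K (Δ * ((T : ℂ) - y * I))‖ * ‖1 - ((T : ℂ) - y * I) ^ 2 / (T : ℂ) ^ 2‖ *
            ‖φ ((T : ℂ) - y * I)‖
          ≤ (Real.exp (2 * π * (Δ * y)) / (Δ * ‖(T : ℂ) - y * I‖)) * (3 * y / T) * (M / y) := by
            gcongr
        _ ≤ (Real.exp (2 * π * (Δ * Y)) / (Δ * T)) * (3 * y / T) * (M / y) := by gcongr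
        _ = _ := by field_simp
    refine (intervalIntegral.norm_integral_le_of_norm_le_const hb).trans (le_of_eq ?_)
    rw [sub_zero, abs_of_pos hY0]
    ring
  refine (le_of_eq (congrArg norm hkey)).trans ((norm_add_le _ _).trans (add_le_add hfar ?_))
  rw [norm_mul, Complex.norm_I, one_mul]
  exact htop

theorem two_mul_integral_im_le {φ χ : ℂ → ℂ} {T Y Δ A M M₁ : ℝ}
    (hY : 1 / 2 ≤ Y) (hYT : Y ≤ T) (hΔ : 0 < Δ) (hΔY : 1 ≤ Δ * Y) (hA : 0 ≤ A)
    (hφ : DifferentiableOn ℂ φ (Set.Icc 0 T ×ℂ Set.Icc (-Y) 0))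
    (hχ : DifferentiableOn ℂ χ (Set.Icc 0 T ×ℂ Set.Icc (-Y) 0))
    (hφM : ∀ y, 0 < y → y ≤ Y → ‖φ (T - y * I)‖ ≤ M / y)
    (hχM : ∀ y, 0 < y → y ≤ Y → ‖χ (T - y * I)‖ ≤ M / y)
    (hφM₁ : ∀ v, 0 ≤ v → v ≤ T → ‖φ (v - Y * I)‖ ≤ M₁)
    (hχM₁ : ∀ v, 0 ≤ v → v ≤ T → ‖χ (v - Y * I)‖ ≤ M₁)
    (hφA : ∀ v : ℝ, 0 ≤ v → v ≤ T → -A ≤ (φ v).re)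
    (hχA : ∀ v : ℝ, 0 ≤ v → v ≤ T → -A ≤ (χ v).re)
    (hconj : ∀ y : ℝ, 0 ≤ y → y ≤ Y → χ (-(y * I)) = starRingEnd ℂ (φ (-(y * I)))) :
    2 * ∫ y in (0 : ℝ)..Y, (φ (-(y * I))).im * (1 + y ^ 2 / T ^ 2) ≤
      A / Δ + 2 * (6 * M₁ * Real.exp (2 * π * (Δ * Y)) / Δ * Real.log (2 * T + 1) +
        3 * M * Y * Real.exp (2 * π * (Δ * Y)) / (Δ * T ^ 2)) := by
  have hY0 : 0 < Y := by linarith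
  have hT0 : 0 < T := by linarith
  have hP := norm_kernel_contour_le differentiableOn_kerP (fun z => norm_kerP_le) hY hYT hΔ hΔY
    hφ hφM hφM₁
  have hQ := norm_kernel_contour_le differentiableOn_kerQ (fun z => norm_kerQ_le) hY hYT hΔ hΔY
    hχ hχM hχM₁
  set E : ℝ := 6 * M₁ * Real.exp (2 * π * (Δ * Y)) / Δ * Real.log (2 * T + 1) +
    3 * M * Y * Real.exp (2 * π * (Δ * Y)) / (Δ * T ^ 2)
  set F : ℂ → ℂ := fun z => kerP (Δ * z) * (1 - z ^ 2 / (T : ℂ) ^ 2) * φ z with hF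
  set G : ℂ → ℂ := fun z => kerQ (Δ * z) * (1 - z ^ 2 / (T : ℂ) ^ 2) * χ z with hG
  have hdiff : ∀ {K ψ : ℂ → ℂ}, DifferentiableOn ℂ K {z | -(1 / 2) < z.re} →
      DifferentiableOn ℂ ψ (Set.Icc 0 T ×ℂ Set.Icc (-Y) 0) →
      ContinuousOn (fun z => K (Δ * z) * (1 - z ^ 2 / (T : ℂ) ^ 2) * ψ z)
        (Set.Icc 0 T ×ℂ Set.Icc (-Y) 0) := by
    intro K ψ hK hψ
    refine (DifferentiableOn.mul (DifferentiableOn.mul ?_ (by fun_prop)) hψ).continuousOn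
    refine hK.comp (by fun_prop) fun z hz => ?_
    have h1 : 0 ≤ Δ * z.re := mul_nonneg hΔ.le hz.1.1
    simp only [Set.mem_ofPred_eq, re_ofReal_mul]
    linarith
  have hFc : ContinuousOn F _ := hdiff differentiableOn_kerP hφ
  have hGc : ContinuousOn G _ := hdiff differentiableOn_kerQ hχ
  have hbot : ∀ {H : ℂ → ℂ}, ContinuousOn H (Set.Icc 0 T ×ℂ Set.Icc (-Y) 0) →
      IntervalIntegrable (fun v : ℝ => H v) volume 0 T := by
    intro H hH
    refine ContinuousOn.intervalIntegrable (hH.comp (by fun_prop) fun v hv => ?_)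
    rw [Set.uIcc_of_le hT0.le] at hv
    exact ⟨by simpa using hv, by simp [hY0.le]⟩
  have hleft : ∀ {H : ℂ → ℂ}, ContinuousOn H (Set.Icc 0 T ×ℂ Set.Icc (-Y) 0) →
      IntervalIntegrable (fun y : ℝ => H (-(y * I))) volume 0 Y := by
    intro H hH
    refine ContinuousOn.intervalIntegrable (hH.comp (by fun_prop) fun y hy => ?_)
    rw [Set.uIcc_of_le hY0.le] at hy
    exact ⟨by simp [hT0.le], by simpa using hy.symm⟩
  have hsum : (∫ v in (0 : ℝ)..T, (F v + G v).re) +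
      -(∫ y in (0 : ℝ)..Y, (F (-(y * I)) + G (-(y * I))).im) ≤ 2 * E := by
    have e1 : ∫ v in (0 : ℝ)..T, (F v + G v).re =
        ((∫ v in (0 : ℝ)..T, F v) + ∫ v in (0 : ℝ)..T, G v).re := by
      rw [← intervalIntegral.integral_add (hbot hFc) (hbot hGc)]
      exact Complex.reCLM.intervalIntegral_comp_comm ((hbot hFc).add (hbot hGc))
    have e2 : ∫ y in (0 : ℝ)..Y, (F (-(y * I)) + G (-(y * I))).im =
        ((∫ y in (0 : ℝ)..Y, F (-(y * I))) + ∫ y in (0 : ℝ)..Y, G (-(y * I))).im := by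
      rw [← intervalIntegral.integral_add (hleft hFc) (hleft hGc)]
      exact Complex.imCLM.intervalIntegral_comp_comm ((hleft hFc).add (hleft hGc))
    rw [e1, e2]
    have h1 := (Complex.re_le_norm _).trans hP
    have h2 := (Complex.re_le_norm _).trans hQ
    simp only [add_re, I_mul_re, add_im] at h1 h2 ⊢
    linarith
  have hlow : -(A / Δ) ≤ ∫ v in (0 : ℝ)..T, (F v + G v).re := by
    have hc : Continuous fun v : ℝ => -A * (2 * Real.sinc (π * (Δ * v)) ^ 2) := by
      have := Real.continuous_sinc
      fun_prop
    have hi : ∫ v in (0 : ℝ)..T, 2 * Real.sinc (π * (Δ * v)) ^ 2 ≤ 1 / Δ := by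
      rw [intervalIntegral.integral_comp_mul_left (fun u => 2 * Real.sinc (π * u) ^ 2) hΔ.ne',
        mul_zero, smul_eq_mul, one_div]
      exact mul_le_of_le_one_right (by positivity)
        (integral_sinc_sq_le_half _ (by positivity))
    calc -(A / Δ) = -A * (1 / Δ) := by ring
      _ ≤ -A * ∫ v in (0 : ℝ)..T, 2 * Real.sinc (π * (Δ * v)) ^ 2 :=
          mul_le_mul_of_nonpos_left hi (by linarith)
      _ = ∫ v in (0 : ℝ)..T, -A * (2 * Real.sinc (π * (Δ * v)) ^ 2) := by
          rw [← intervalIntegral.integral_const_mul]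
      _ ≤ _ := by
          refine intervalIntegral.integral_mono_on hT0.le (hc.intervalIntegrable _ _) ?_
            fun v hv => ?_
          · have h := (hbot hFc).add (hbot hGc)
            exact ⟨Complex.reCLM.integrable_comp h.1, Complex.reCLM.integrable_comp h.2⟩
          obtain ⟨hv0, hvT⟩ := hv
          obtain ⟨ha, ha', hb, hb'⟩ := exists_kerP_kerQ_ofReal (mul_nonneg hΔ.le hv0)
          have hab := kerP_add_kerQ ((Δ * v : ℝ) : ℂ)
          rw [sincPi_ofReal] at hab
          have hPa : kerP ((Δ * v : ℝ) : ℂ) = ((kerP ((Δ * v : ℝ) : ℂ)).re : ℂ) :=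
            Complex.ext rfl (by rw [ha', Complex.ofReal_im])
          have hQb : kerQ ((Δ * v : ℝ) : ℂ) = ((kerQ ((Δ * v : ℝ) : ℂ)).re : ℂ) :=
            Complex.ext rfl (by rw [hb', Complex.ofReal_im])
          generalize (kerP ((Δ * v : ℝ) : ℂ)).re = a at *
          generalize (kerQ ((Δ * v : ℝ) : ℂ)).re = b at *
          rw [hPa, hQb] at hab
          have hab' : a + b = 2 * Real.sinc (π * (Δ * v)) ^ 2 := by exact_mod_cast hab
          have hp : (1 - (v : ℂ) ^ 2 / (T : ℂ) ^ 2) = ((1 - v ^ 2 / T ^ 2 : ℝ) : ℂ) := by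
            push_cast; ring
          have hp1 : 1 - v ^ 2 / T ^ 2 ≤ 1 := by
            have : 0 ≤ v ^ 2 / T ^ 2 := by positivity
            linarith
          have hp0 : 0 ≤ 1 - v ^ 2 / T ^ 2 := by
            have : v ^ 2 / T ^ 2 ≤ 1 := by
              rw [div_le_one (by positivity)]; gcongr
            linarith
          simp only [hF, hG, hPa, hQb, hp, ← Complex.ofReal_mul, add_re, re_ofReal_mul]
          generalize 1 - v ^ 2 / T ^ 2 = p at hp0 hp1
          rw [← hab']
          have h1 := mul_le_mul_of_nonneg_left (hφA v hv0 hvT) (mul_nonneg ha hp0)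
          have h2 := mul_le_mul_of_nonneg_left (hχA v hv0 hvT) (mul_nonneg hb hp0)
          have h3 : A * ((a + b) * p) ≤ A * ((a + b) * 1) := by gcongr
          linarith
  have him : ∫ y in (0 : ℝ)..Y, (F (-(y * I)) + G (-(y * I))).im =
      -(2 * ∫ y in (0 : ℝ)..Y, (φ (-(y * I))).im * (1 + y ^ 2 / T ^ 2)) := by
    rw [← intervalIntegral.integral_const_mul, ← intervalIntegral.integral_neg]
    refine intervalIntegral.integral_congr fun y hy => ?_
    rw [Set.uIcc_of_le hY0.le] at hy
    have hq := kerQ_neg_I_mul (mul_nonneg hΔ.le hy.1)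
    have harg : (Δ : ℂ) * -((y : ℂ) * I) = -(((Δ * y : ℝ) : ℂ) * I) := by push_cast; ring
    have hp : 1 - (-((y : ℂ) * I)) ^ 2 / (T : ℂ) ^ 2 = ((1 + y ^ 2 / T ^ 2 : ℝ) : ℂ) := by
      push_cast
      rw [neg_sq, mul_pow, I_sq]
      ring
    simp only [hF, hG, harg, hq, hconj y hy.1 hy.2, hp]
    simp only [add_im, mul_im, mul_re, add_re, conj_re, conj_im, ofReal_re, ofReal_im, re_ofNat,
      im_ofNat]
    ring
  rw [him] at hsum
  linarith

end FejerPair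

/-! ### Bounding the argument function -/

theorem logDeriv_riemannZeta_conj (s : ℂ) :
    logDeriv riemannZeta (starRingEnd ℂ s) = starRingEnd ℂ (logDeriv riemannZeta s) := by
  have h : starRingEnd ℂ ∘ riemannZeta ∘ starRingEnd ℂ = riemannZeta := by
    ext s
    simp [riemannZeta_conj]
  have h1 : deriv riemannZeta (starRingEnd ℂ s) = starRingEnd ℂ (deriv riemannZeta s) := by
    have := congrFun (deriv_conj_conj (f := riemannZeta)) (starRingEnd ℂ s)
    rw [h] at this
    simpa using this
  rw [logDeriv_apply, logDeriv_apply, h1, riemannZeta_conj, map_div₀]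

theorem differentiableAt_logDeriv_riemannZeta {s : ℂ} (h1 : s ≠ 1) (h0 : riemannZeta s ≠ 0) :
    DifferentiableAt ℂ (logDeriv riemannZeta) s := by
  have hζ' : DifferentiableAt ℂ (deriv riemannZeta) s := by
    have : DifferentiableOn ℂ riemannZeta {1}ᶜ := differentiableOn_riemannZeta
    exact (this.deriv isOpen_compl_singleton).differentiableAt
      (isOpen_compl_singleton.mem_nhds h1)
  exact hζ'.div (differentiableAt_riemannZeta h1) h0

theorem RiemannHypothesis.integral_im_logDeriv_le (hRH : RiemannHypothesis)
    {u η δ T Δ : ℝ} (hη : 0 < η) (hδ : 0 < δ) (hηδ : η + δ ≤ 1) (hT : 1 / 2 + δ ≤ T)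
    (hu : T + 3 ≤ u) (hΔ : 0 < Δ) (hΔδ : 1 ≤ Δ * (1 / 2 + δ)) {ε : ℝ} (hε : ε = 1 ∨ ε = -1) :
    2 * ∫ y in (0 : ℝ)..(1 / 2 + δ),
      (logDeriv riemannZeta ((1 / 2 + η + y : ℝ) + (ε * u : ℝ) * I)).im * (1 + y ^ 2 / T ^ 2) ≤
      (2 + Real.log (u + T + 4) / 2) / Δ +
        2 * (6 * (6 / δ ^ 2) * Real.exp (2 * π * (Δ * (1 / 2 + δ))) / Δ * Real.log (2 * T + 1) +
        3 * (24 + 2 * Real.log (u + T + 6)) * (1 / 2 + δ) *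
          Real.exp (2 * π * (Δ * (1 / 2 + δ))) / (Δ * T ^ 2)) := by
  have hT0 : 0 < T := by linarith
  have hlog4 : 0 ≤ Real.log (u + T + 4) := Real.log_nonneg (by linarith)
  have harg : ∀ (e v y : ℝ), ((1 / 2 + η : ℝ) : ℂ) + (e * u : ℝ) * I + I * (v - y * I) =
      ((1 / 2 + η + y : ℝ) : ℂ) + (e * u + v : ℝ) * I := by
    intro e v y
    push_cast
    linear_combination (-(y : ℂ)) * I_sq
  have hflip : ∀ x w : ℝ, (x : ℂ) + (w : ℝ) * I = starRingEnd ℂ ((x : ℂ) + (-w : ℝ) * I) := by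
    intro x w
    simp
  have hre : ∀ x w : ℝ, ((x : ℂ) + (w : ℝ) * I).re = x := by intro x w; simp
  have him : ∀ x w : ℝ, ((x : ℂ) + (w : ℝ) * I).im = w := by intro x w; simp
  have hreb : ∀ x w : ℝ, 1 / 2 < x → x ≤ 4 → 1 ≤ w → w ≤ u + T →
      -(2 + Real.log (u + T + 4) / 2) ≤ (logDeriv riemannZeta (x + w * I)).re := by
    intro x w h1 h2 h3 h4
    have h := hRH.neg_le_re_deriv_zeta_div_zeta (s := x + w * I) (by rwa [hre]) (by rwa [hre])
      (by rwa [him])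
    rw [him] at h
    have h5 : Real.log (w + 4) ≤ Real.log (u + T + 4) := Real.log_le_log (by linarith) (by linarith)
    rw [logDeriv_apply]
    linarith
  have hnb : ∀ y w : ℝ, 0 < y → y ≤ 1 / 2 + δ → 3 ≤ w → w ≤ u + T →
      ‖logDeriv riemannZeta ((1 / 2 + η + y : ℝ) + w * I)‖ ≤
        (24 + 2 * Real.log (u + T + 6)) / y := by
    intro y w h1 h2 h3 h4
    have h := hRH.norm_deriv_zeta_div_zeta_le (s := (1 / 2 + η + y : ℝ) + w * I)
      (by rw [hre]; linarith) (by rw [hre]; linarith) (by rwa [him])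
    rw [him, hre] at h
    have h5 : Real.log (w + 6) ≤ Real.log (u + T + 6) := Real.log_le_log (by linarith) (by linarith)
    have h6 : 0 ≤ Real.log (w + 6) := Real.log_nonneg (by linarith)
    rw [logDeriv_apply]
    refine h.trans ?_
    apply div_le_div₀ (by linarith) (by linarith) h1 (by linarith)
  have hn1 : ∀ w : ℝ, ‖logDeriv riemannZeta ((1 / 2 + η + (1 / 2 + δ) : ℝ) + w * I)‖ ≤
      6 / δ ^ 2 := by
    intro w
    have h := _root_.norm_deriv_zeta_div_zeta_le hδ (by linarith)
      (s := (1 / 2 + η + (1 / 2 + δ) : ℝ) + w * I) (by rw [hre]; linarith)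
    rw [hre] at h
    rw [logDeriv_apply]
    refine h.trans (mul_le_of_le_one_right (by positivity) ?_)
    exact Real.rpow_le_one_of_one_le_of_nonpos (by norm_num) (by linarith)
  have hpm : ∀ e v : ℝ, e = 1 ∨ e = -1 → 0 ≤ v → v ≤ T →
      (3 ≤ e * u + v ∧ e * u + v ≤ u + T) ∨ (3 ≤ -(e * u + v) ∧ -(e * u + v) ≤ u + T) := by
    rintro e v (rfl | rfl) h1 h2
    · left; constructor <;> linarith
    · right; constructor <;> linarith
  have hsym : ∀ x w : ℝ, logDeriv riemannZeta (x + w * I) =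
      starRingEnd ℂ (logDeriv riemannZeta (x + (-w : ℝ) * I)) := by
    intro x w
    rw [← logDeriv_riemannZeta_conj, ← hflip]
  have hall : ∀ e : ℝ, e = 1 ∨ e = -1 →
      DifferentiableOn ℂ (fun z => logDeriv riemannZeta
        (((1 / 2 + η : ℝ) : ℂ) + (e * u : ℝ) * I + I * z))
        (Set.Icc 0 T ×ℂ Set.Icc (-(1 / 2 + δ)) 0) ∧
      (∀ v y : ℝ, 0 ≤ v → v ≤ T → 0 < y → y ≤ 1 / 2 + δ →
        ‖logDeriv riemannZeta
          (((1 / 2 + η : ℝ) : ℂ) + (e * u : ℝ) * I + I * (v - y * I))‖ ≤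
          (24 + 2 * Real.log (u + T + 6)) / y) ∧
      (∀ v : ℝ, 0 ≤ v → v ≤ T → -(2 + Real.log (u + T + 4) / 2) ≤
        (logDeriv riemannZeta (((1 / 2 + η : ℝ) : ℂ) + (e * u : ℝ) * I + I * v)).re) := by
    intro e he
    refine ⟨fun z hz => ?_, fun v y hv0 hvT hy0 hy1 => ?_, fun v hv0 hvT => ?_⟩
    · have h1 : ((1 / 2 + η : ℝ) : ℂ) + (e * u : ℝ) * I + I * z =
          ((1 / 2 + η + -z.im : ℝ) : ℂ) + (e * u + z.re : ℝ) * I := by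
        rw [← harg]
        congr 2
        apply Complex.ext <;> simp
      have hzim : 0 ≤ -z.im := by linarith [hz.2.2]
      have h2 : riemannZeta (((1 / 2 + η : ℝ) : ℂ) + (e * u : ℝ) * I + I * z) ≠ 0 := by
        rw [h1]
        exact hRH.ne_zero (by rw [hre]; linarith)
      have h3 : ((1 / 2 + η : ℝ) : ℂ) + (e * u : ℝ) * I + I * z ≠ 1 := by
        rw [h1]
        intro h
        have h4 := congrArg Complex.im h
        rw [him, one_im] at h4
        rcases hpm e z.re he hz.1.1 hz.1.2 with h5 | h5 <;> linarith [h5.1]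
      exact (DifferentiableAt.comp z (differentiableAt_logDeriv_riemannZeta h3 h2)
        (by fun_prop)).differentiableWithinAt
    · rw [harg]
      rcases hpm e v he hv0 hvT with h5 | h5
      · exact hnb _ _ hy0 hy1 h5.1 h5.2
      · rw [hsym, RCLike.norm_conj]
        exact hnb _ _ hy0 hy1 h5.1 h5.2
    · have h := harg e v 0
      rw [Complex.ofReal_zero, zero_mul, sub_zero] at h
      rw [h]
      rcases hpm e v he hv0 hvT with h5 | h5
      · exact hreb _ _ (by linarith) (by linarith) (by linarith) h5.2
      · rw [hsym, conj_re]
        exact hreb _ _ (by linarith) (by linarith) (by linarith) h5.2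
  have hε' : -ε = 1 ∨ -ε = -1 := by
    rcases hε with rfl | rfl <;> simp
  obtain ⟨a1, a2, a3⟩ := hall ε hε
  obtain ⟨b1, b2, b3⟩ := hall (-ε) hε'
  have hmain := FejerPair.two_mul_integral_im_le (M₁ := 6 / δ ^ 2) (by linarith) hT hΔ hΔδ
    (by linarith) a1 b1
    (fun y => a2 T y hT0.le le_rfl) (fun y => b2 T y hT0.le le_rfl)
    (fun v _ _ => by rw [harg]; exact hn1 _) (fun v _ _ => by rw [harg]; exact hn1 _) a3 b3
    (fun y _ _ => by
      have h := fun e => harg e 0 y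
      simp only [Complex.ofReal_zero, zero_sub, add_zero] at h
      rw [h, h, hsym]
      simp)
  have h := fun y => harg ε 0 y
  simp only [Complex.ofReal_zero, zero_sub, add_zero] at h
  simpa only [h] using hmain

theorem integrableOn_im_logDeriv_Ioi (u : ℝ) {δ c : ℝ} (hδ : 0 < δ) (hδ1 : δ ≤ 1)
    (hc : 1 + δ ≤ c)
    (hcont : ContinuousOn (fun σ : ℝ => (logDeriv riemannZeta (σ + u * I)).im) (Set.Ici c)) :
    IntegrableOn (fun σ : ℝ => (logDeriv riemannZeta (σ + u * I)).im) (Set.Ioi c) ∧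
      |∫ σ in Set.Ioi c, (logDeriv riemannZeta (σ + u * I)).im| ≤ 9 / δ ^ 2 := by
  have hl2 : 0 < Real.log 2 := Real.log_pos one_lt_two
  have hdom : IntegrableOn (fun σ : ℝ => 6 / δ ^ 2 * Real.exp (Real.log 2 * (1 + δ)) *
      Real.exp (-Real.log 2 * σ)) (Set.Ioi c) :=
    (integrableOn_exp_mul_Ioi (by linarith) c).const_mul _
  have hb : ∀ σ ∈ Set.Ioi c, ‖(logDeriv riemannZeta (σ + u * I)).im‖ ≤
      6 / δ ^ 2 * Real.exp (Real.log 2 * (1 + δ)) * Real.exp (-Real.log 2 * σ) := by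
    intro σ hσ
    have hσ' : c < σ := hσ
    have hre : ((σ : ℂ) + u * I).re = σ := by simp
    have h := norm_deriv_zeta_div_zeta_le hδ hδ1 (s := (σ : ℂ) + u * I) (by rw [hre]; linarith)
    rw [hre, Real.rpow_def_of_pos two_pos] at h
    rw [Real.norm_eq_abs, mul_assoc, ← Real.exp_add]
    refine (Complex.abs_im_le_norm _).trans (h.trans (le_of_eq ?_))
    congr 2
    ring
  have hae := (ae_restrict_iff' measurableSet_Ioi (μ := volume)).2 (Filter.Eventually.of_forall hb)
  have hmeas := (hcont.mono Set.Ioi_subset_Ici_self).aestronglyMeasurable measurableSet_Ioi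
    (μ := volume)
  refine ⟨Integrable.mono' hdom hmeas hae, ?_⟩
  rw [← Real.norm_eq_abs]
  refine (norm_integral_le_of_norm_le hdom hae).trans ?_
  rw [integral_const_mul, integral_exp_mul_Ioi (by linarith)]
  have h1 : Real.exp (Real.log 2 * (1 + δ)) * Real.exp (-Real.log 2 * c) ≤ 1 := by
    rw [← Real.exp_add, Real.exp_le_one_iff]
    nlinarith
  have h2 : (2 : ℝ) / 3 ≤ Real.log 2 := by linarith [Real.log_two_gt_d9]
  calc 6 / δ ^ 2 * Real.exp (Real.log 2 * (1 + δ)) * (-Real.exp (-Real.log 2 * c) / -Real.log 2)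
      = 6 / δ ^ 2 * (Real.exp (Real.log 2 * (1 + δ)) * Real.exp (-Real.log 2 * c)) /
          Real.log 2 := by rw [neg_div_neg_eq]; ring
    _ ≤ 6 / δ ^ 2 * 1 / (2 / 3) := by gcongr
    _ = 9 / δ ^ 2 := by ring

theorem RiemannHypothesis.continuousOn_im_logDeriv (hRH : RiemannHypothesis) {u : ℝ} (hu : u ≠ 0)
    (hz : ¬ IsZetaZeroOrdinate u) :
    ContinuousOn (fun σ : ℝ => (logDeriv riemannZeta (σ + u * I)).im) (Set.Ici (1 / 2)) := by
  intro σ hσ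
  have hre : ((σ : ℂ) + u * I).re = σ := by simp
  have him : ((σ : ℂ) + u * I).im = u := by simp
  have h1 : (σ : ℂ) + u * I ≠ 1 := by
    intro h
    rw [h, one_im] at him
    exact hu him.symm
  have h0 : riemannZeta (σ + u * I) ≠ 0 := by
    rcases (Set.mem_Ici.1 hσ).eq_or_lt with h | h
    · intro h0
      exact hz ⟨_, h0, by rw [hre]; linarith, by rw [hre]; linarith, him⟩
    · exact hRH.ne_zero (by rwa [hre])
  have h2 := (differentiableAt_logDeriv_riemannZeta h1 h0).continuousAt
  have h3 : ContinuousAt (fun σ : ℝ => (σ : ℂ) + u * I) σ := by fun_prop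
  exact (Complex.continuous_im.continuousAt.comp
    (ContinuousAt.comp (f := fun σ : ℝ => (σ : ℂ) + u * I) h2 h3)).continuousWithinAt

theorem RiemannHypothesis.abs_integral_im_logDeriv_le (hRH : RiemannHypothesis)
    {u η δ T Δ : ℝ} (hη : 0 < η) (hδ : 0 < δ) (hηδ : η + δ ≤ 1) (hT : 1 / 2 + δ ≤ T)
    (hu : T + 3 ≤ u) (hΔ : 0 < Δ) (hΔδ : 1 ≤ Δ * (1 / 2 + δ))
    (hcont : ContinuousOn (fun σ : ℝ => (logDeriv riemannZeta (σ + u * I)).im)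
      (Set.Ici (1 / 2))) :
    |∫ y in (0 : ℝ)..(1 / 2 + δ), (logDeriv riemannZeta ((1 / 2 + η + y : ℝ) + u * I)).im| ≤
      (2 + Real.log (u + T + 4) / 2) / (2 * Δ) +
        (6 * (6 / δ ^ 2) * Real.exp (2 * π * (Δ * (1 / 2 + δ))) / Δ * Real.log (2 * T + 1) +
        3 * (24 + 2 * Real.log (u + T + 6)) * (1 / 2 + δ) *
          Real.exp (2 * π * (Δ * (1 / 2 + δ))) / (Δ * T ^ 2)) +
        (24 + 2 * Real.log (u + T + 6)) * (1 / 2 + δ) ^ 2 / T ^ 2 := by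
  have hT0 : 0 < T := by linarith
  have h1 := hRH.integral_im_logDeriv_le hη hδ hηδ hT hu hΔ hΔδ (Or.inl rfl)
  have h2 := hRH.integral_im_logDeriv_le hη hδ hηδ hT hu hΔ hΔδ (Or.inr rfl)
  have hneg : ∀ x : ℝ, (logDeriv riemannZeta (x + (-1 * u : ℝ) * I)).im =
      -(logDeriv riemannZeta (x + u * I)).im := by
    intro x
    have : (x : ℂ) + (-1 * u : ℝ) * I = starRingEnd ℂ (x + u * I) := by simp
    rw [this, logDeriv_riemannZeta_conj, conj_im]
  simp only [hneg] at h2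
  simp only [neg_mul, intervalIntegral.integral_neg] at h2
  simp only [one_mul] at h1
  set g : ℝ → ℝ := fun y => (logDeriv riemannZeta ((1 / 2 + η + y : ℝ) + u * I)).im with hg
  have hgc : ContinuousOn g (Set.uIcc 0 (1 / 2 + δ)) := by
    refine hcont.comp (f := fun y : ℝ => 1 / 2 + η + y) (by fun_prop) fun y hy => ?_
    rw [Set.uIcc_of_le (by linarith)] at hy
    simp only [Set.mem_Ici]
    linarith [hy.1]
  have hi1 : IntervalIntegrable g volume 0 (1 / 2 + δ) := hgc.intervalIntegrable
  have hi2 : IntervalIntegrable (fun y => g y * (y ^ 2 / T ^ 2)) volume 0 (1 / 2 + δ) :=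
    (hgc.mul (by fun_prop)).intervalIntegrable
  have hsplit : ∫ y in (0 : ℝ)..(1 / 2 + δ), g y * (1 + y ^ 2 / T ^ 2) =
      (∫ y in (0 : ℝ)..(1 / 2 + δ), g y) + ∫ y in (0 : ℝ)..(1 / 2 + δ), g y * (y ^ 2 / T ^ 2) := by
    rw [← intervalIntegral.integral_add hi1 hi2]
    congr 1; ext y; ring
  have hb : ∀ y ∈ Set.uIoc 0 (1 / 2 + δ), ‖g y * (y ^ 2 / T ^ 2)‖ ≤
      (24 + 2 * Real.log (u + T + 6)) * (1 / 2 + δ) / T ^ 2 := by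
    intro y hy
    rw [Set.uIoc_of_le (by linarith)] at hy
    obtain ⟨hy0, hy1⟩ := hy
    have hre : (((1 / 2 + η + y : ℝ) : ℂ) + u * I).re = 1 / 2 + η + y := by simp
    have him : (((1 / 2 + η + y : ℝ) : ℂ) + u * I).im = u := by simp
    have h := hRH.norm_deriv_zeta_div_zeta_le (s := (1 / 2 + η + y : ℝ) + u * I)
      (by rw [hre]; linarith) (by rw [hre]; linarith) (by rw [him]; linarith)
    rw [him, hre] at h
    have h5 : Real.log (u + 6) ≤ Real.log (u + T + 6) := Real.log_le_log (by linarith) (by linarith)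
    have h6 : 0 ≤ Real.log (u + 6) := Real.log_nonneg (by linarith)
    have h7 : |g y| ≤ (24 + 2 * Real.log (u + T + 6)) / y := by
      refine (Complex.abs_im_le_norm _).trans (h.trans ?_)
      apply div_le_div₀ (by linarith) (by linarith) hy0 (by linarith)
    rw [norm_mul, Real.norm_eq_abs, Real.norm_eq_abs, abs_of_nonneg (by positivity : (0 : ℝ) ≤ y ^ 2 / T ^ 2)]
    calc |g y| * (y ^ 2 / T ^ 2) ≤ (24 + 2 * Real.log (u + T + 6)) / y * (y ^ 2 / T ^ 2) := by
          gcongr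
      _ = (24 + 2 * Real.log (u + T + 6)) * y / T ^ 2 := by field_simp
      _ ≤ _ := by
          have : 0 ≤ 24 + 2 * Real.log (u + T + 6) := by linarith
          gcongr
  have h3 := intervalIntegral.norm_integral_le_of_norm_le_const hb
  rw [sub_zero, abs_of_pos (by linarith : (0 : ℝ) < 1 / 2 + δ), Real.norm_eq_abs, abs_le] at h3
  have h4 : (24 + 2 * Real.log (u + T + 6)) * (1 / 2 + δ) / T ^ 2 * (1 / 2 + δ) =
      (24 + 2 * Real.log (u + T + 6)) * (1 / 2 + δ) ^ 2 / T ^ 2 := by ring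
  rw [h4] at h3
  have h5 : (2 + Real.log (u + T + 4) / 2) / (2 * Δ) =
      (2 + Real.log (u + T + 4) / 2) / Δ / 2 := by rw [div_div, mul_comm]
  rw [hsplit] at h1 h2
  rw [h5, abs_le]
  constructor <;> linarith [h3.1, h3.2]

theorem RiemannHypothesis.abs_S_le (hRH : RiemannHypothesis)
    {u δ T Δ : ℝ} (hδ : 0 < δ) (hδ1 : δ ≤ 1 / 2) (hT : 1 / 2 + δ ≤ T)
    (hu : T + 3 ≤ u) (hΔ : 0 < Δ) (hΔδ : 1 ≤ Δ * (1 / 2 + δ)) (hz : ¬ IsZetaZeroOrdinate u) :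
    |S u| ≤ 1 / π * ((2 + Real.log (u + T + 4) / 2) / (2 * Δ) +
        (6 * (6 / δ ^ 2) * Real.exp (2 * π * (Δ * (1 / 2 + δ))) / Δ * Real.log (2 * T + 1) +
        3 * (24 + 2 * Real.log (u + T + 6)) * (1 / 2 + δ) *
          Real.exp (2 * π * (Δ * (1 / 2 + δ))) / (Δ * T ^ 2)) +
        (24 + 2 * Real.log (u + T + 6)) * (1 / 2 + δ) ^ 2 / T ^ 2 + 9 / δ ^ 2) := by
  have hcont := hRH.continuousOn_im_logDeriv (u := u) (by linarith) hz
  set R : ℝ := (2 + Real.log (u + T + 4) / 2) / (2 * Δ) +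
        (6 * (6 / δ ^ 2) * Real.exp (2 * π * (Δ * (1 / 2 + δ))) / Δ * Real.log (2 * T + 1) +
        3 * (24 + 2 * Real.log (u + T + 6)) * (1 / 2 + δ) *
          Real.exp (2 * π * (Δ * (1 / 2 + δ))) / (Δ * T ^ 2)) +
        (24 + 2 * Real.log (u + T + 6)) * (1 / 2 + δ) ^ 2 / T ^ 2 with hR
  set g : ℝ → ℝ := fun σ => (logDeriv riemannZeta (σ + u * I)).im with hg
  have hS : S u = -(1 / π) * ∫ σ in Set.Ioi (1 / 2 : ℝ), g σ := rfl
  have hint : ∀ a b : ℝ, 1 / 2 ≤ a → a ≤ b → IntervalIntegrable g volume a b := by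
    intro a b ha hab
    refine (hcont.mono fun x hx => ?_).intervalIntegrable
    rw [Set.uIcc_of_le hab] at hx
    exact ha.trans hx.1
  obtain ⟨B, hB⟩ : ∃ B, ∀ σ ∈ Set.Icc (1 / 2 : ℝ) 1, ‖g σ‖ ≤ B :=
    isCompact_Icc.exists_bound_of_continuousOn (hcont.mono Set.Icc_subset_Ici_self)
  have hB0 : 0 ≤ B := (norm_nonneg _).trans (hB (1 / 2) ⟨le_rfl, by norm_num⟩)
  have hmain : ∀ η : ℝ, 0 < η → η ≤ 1 / 2 →
      |∫ σ in Set.Ioi (1 / 2 : ℝ), g σ| ≤ R + 9 / δ ^ 2 + B * η := by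
    intro η hη hη1
    obtain ⟨htail, htailb⟩ := integrableOn_im_logDeriv_Ioi u hδ (by linarith)
      (c := 1 / 2 + η + (1 / 2 + δ)) (by linarith)
      (hcont.mono (Set.Ici_subset_Ici.2 (by linarith)))
    have hmid := hRH.abs_integral_im_logDeriv_le hη hδ (by linarith) hT hu hΔ hΔδ hcont
    have hchange : ∫ y in (0 : ℝ)..(1 / 2 + δ),
        (logDeriv riemannZeta ((1 / 2 + η + y : ℝ) + u * I)).im =
        ∫ σ in (1 / 2 + η)..(1 / 2 + η + (1 / 2 + δ)), g σ := by
      have := intervalIntegral.integral_comp_add_left g (1 / 2 + η) (a := 0) (b := 1 / 2 + δ)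
      rw [add_zero] at this
      exact this
    rw [hchange] at hmid
    have h2 : IntegrableOn g (Set.Ioi (1 / 2 + η)) := by
      have := (hint (1 / 2 + η) (1 / 2 + η + (1 / 2 + δ)) (by linarith) (by linarith)).1.union htail
      rwa [Set.Ioc_union_Ioi_eq_Ioi (by linarith)] at this
    have e1 := intervalIntegral.integral_interval_add_Ioi' (hint (1 / 2) (1 / 2 + η) le_rfl
      (by linarith)) h2
    have e2 := intervalIntegral.integral_interval_add_Ioi' (hint (1 / 2 + η)
      (1 / 2 + η + (1 / 2 + δ)) (by linarith) (by linarith)) htail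
    have h3 : ‖∫ σ in (1 / 2)..(1 / 2 + η), g σ‖ ≤ B * |1 / 2 + η - 1 / 2| := by
      refine intervalIntegral.norm_integral_le_of_norm_le_const fun x hx => ?_
      rw [Set.uIoc_of_le (by linarith)] at hx
      exact hB x ⟨hx.1.le, by linarith [hx.2]⟩
    rw [add_sub_cancel_left, abs_of_pos hη, Real.norm_eq_abs] at h3
    rw [← e1, ← e2]
    have h4 := abs_add_le (∫ σ in (1 / 2)..(1 / 2 + η), g σ)
      ((∫ σ in (1 / 2 + η)..(1 / 2 + η + (1 / 2 + δ)), g σ) +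
        ∫ σ in Set.Ioi (1 / 2 + η + (1 / 2 + δ)), g σ)
    have h5 := abs_add_le (∫ σ in (1 / 2 + η)..(1 / 2 + η + (1 / 2 + δ)), g σ)
      (∫ σ in Set.Ioi (1 / 2 + η + (1 / 2 + δ)), g σ)
    linarith
  have hlim : |∫ σ in Set.Ioi (1 / 2 : ℝ), g σ| ≤ R + 9 / δ ^ 2 := by
    refine le_of_forall_pos_le_add fun ε hε => ?_
    have h1 : 0 < ε / (B + 1) := by positivity
    refine (hmain (min (ε / (B + 1)) (1 / 2)) (lt_min h1 (by norm_num)) (min_le_right _ _)).trans ?_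
    have h2 : B * min (ε / (B + 1)) (1 / 2) ≤ ε := by
      calc B * min (ε / (B + 1)) (1 / 2) ≤ (B + 1) * (ε / (B + 1)) := by
            gcongr
            · linarith
            · exact min_le_left _ _
        _ = ε := by field_simp
    linarith
  rw [hS, abs_mul, abs_neg, abs_of_pos (by positivity : 0 < 1 / π)]
  gcongr

/-- The size estimate for the bound on `|S u|` with `l = log L` and `m = log (log L)`. -/
theorem argument_bound_le {L l m P Q Δ E K : ℝ} (hm : 1 ≤ m) (hl : 12 * m ≤ l)
    (hL : 9 * l ^ 4 ≤ L) (hE : E ≤ 9 * (L / l ^ 6))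
    (hE0 : 0 ≤ E) (hΔ : Δ = (l - 6 * m) / π) (hP : P ≤ L + 2) (hQ0 : 0 ≤ Q) (hQ : Q ≤ L + 2)
    (hK0 : 0 ≤ K) (hK : K ≤ 2 * l) :
    1 / π * ((2 + P / 2) / (2 * Δ) +
        (6 * (6 / (1 / l) ^ 2) * E / Δ * K +
        3 * (24 + 2 * Q) * (1 / 2 + 1 / l) * E / (Δ * L ^ 2)) +
        (24 + 2 * Q) * (1 / 2 + 1 / l) ^ 2 / L ^ 2 + 9 / (1 / l) ^ 2) ≤
      1 / 4 * L / l + 10000 * (L * m) / l ^ 2 := by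
  have hl12 : 12 ≤ l := by linarith
  have hl0 : 0 < l := by linarith
  have hl2 : 1 ≤ l ^ 2 := one_le_pow₀ (by linarith)
  have hl4 : l ≤ l ^ 4 := le_self_pow₀ (by linarith) (by norm_num)
  have hL1 : 100 ≤ L := by linarith
  have hL0 : 0 < L := by linarith
  have hπ := pi_gt_three
  have hπ4 := pi_le_four
  have hΔ0 : 0 < Δ := by rw [hΔ]; apply div_pos <;> linarith
  have hΔl : l / 8 ≤ Δ := by
    rw [hΔ, div_le_div_iff₀ (by norm_num) pi_pos]
    nlinarith
  have hX : 1 ≤ L / l ^ 2 := by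
    rw [le_div_iff₀ (by positivity)]
    nlinarith
  have hXm : L / l ^ 2 ≤ L * m / l ^ 2 := by
    gcongr
    nlinarith
  have t1 : 1 / π * ((2 + P / 2) / (2 * Δ)) ≤ 1 / 4 * L / l + 100 * (L * m / l ^ 2) := by
    have e : 1 / π * ((2 + P / 2) / (2 * Δ)) = (2 + P / 2) / (2 * (l - 6 * m)) := by
      rw [hΔ]
      have : l - 6 * m ≠ 0 := by linarith
      field_simp
    have hinv : 1 / (l - 6 * m) ≤ 1 / l + 12 * m / l ^ 2 := by
      have h1 : 1 / l + 12 * m / l ^ 2 = (l + 12 * m) / l ^ 2 := by field_simp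
      rw [h1, div_le_div_iff₀ (by linarith) (by positivity)]
      nlinarith
    have h3 : 1 / l ≤ L * m / l ^ 2 := by
      refine le_trans ?_ (hX.trans hXm)
      rw [div_le_one hl0]
      linarith
    have h4 : m / l ^ 2 ≤ L * m / l ^ 2 := by
      gcongr
      nlinarith
    rw [e]
    calc (2 + P / 2) / (2 * (l - 6 * m)) ≤ (2 + (L + 2) / 2) / (2 * (l - 6 * m)) := by
          have : 0 < l - 6 * m := by linarith
          gcongr
      _ = (L / 4 + 3 / 2) * (1 / (l - 6 * m)) := by
          have : l - 6 * m ≠ 0 := by linarith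
          field_simp; ring
      _ ≤ (L / 4 + 3 / 2) * (1 / l + 12 * m / l ^ 2) := by gcongr
      _ = 1 / 4 * L / l + 3 * (L * m / l ^ 2) + 3 / 2 * (1 / l) + 18 * (m / l ^ 2) := by ring
      _ ≤ _ := by
          have : 0 ≤ L * m / l ^ 2 := by positivity
          linarith
  have t2 : 6 * (6 / (1 / l) ^ 2) * E / Δ * K ≤ 6000 * (L / l ^ 2) := by
    calc 6 * (6 / (1 / l) ^ 2) * E / Δ * K
        ≤ 6 * (6 / (1 / l) ^ 2) * (9 * (L / l ^ 6)) / (l / 8) * (2 * l) := by gcongr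
      _ = 5184 * (L / l ^ 2) * (1 / l ^ 2) := by field_simp; ring
      _ ≤ 6000 * (L / l ^ 2) * 1 := by
          gcongr
          · norm_num
          · rw [div_le_one (by positivity)]; exact hl2
      _ = _ := mul_one _
  have hd : 1 / 2 + 1 / l ≤ 1 := by
    have : 1 / l ≤ 1 / 12 := one_div_le_one_div_of_le (by norm_num) hl12
    linarith
  have hQ' : 24 + 2 * Q ≤ 3 * L := by linarith
  have t3 : 3 * (24 + 2 * Q) * (1 / 2 + 1 / l) * E / (Δ * L ^ 2) ≤ 100 * (L / l ^ 2) := by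
    have hl7 : 1 ≤ l ^ 7 := one_le_pow₀ (by linarith)
    calc 3 * (24 + 2 * Q) * (1 / 2 + 1 / l) * E / (Δ * L ^ 2)
        ≤ 3 * (3 * L) * 1 * (9 * (L / l ^ 6)) / (l / 8 * L ^ 2) := by gcongr
      _ = 648 / l ^ 7 := by field_simp; norm_num
      _ ≤ 100 := by
          rw [div_le_iff₀ (by positivity)]
          have : l ≤ l ^ 7 := le_self_pow₀ (by linarith) (by norm_num)
          linarith
      _ ≤ _ := by linarith
  have t4 : (24 + 2 * Q) * (1 / 2 + 1 / l) ^ 2 / L ^ 2 ≤ 3 * (L / l ^ 2) := by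
    calc (24 + 2 * Q) * (1 / 2 + 1 / l) ^ 2 / L ^ 2 ≤ 3 * L * 1 ^ 2 / L ^ 2 := by gcongr
      _ = 3 / L := by field_simp
      _ ≤ 3 := by
          rw [div_le_iff₀ hL0]; linarith
      _ ≤ _ := by linarith
  have t5 : 9 / (1 / l) ^ 2 ≤ L / l ^ 2 := by
    rw [le_div_iff₀ (by positivity)]
    calc 9 / (1 / l) ^ 2 * l ^ 2 = 9 * l ^ 4 := by field_simp
      _ ≤ L := hL
  have hsum : 1 / π * ((6 * (6 / (1 / l) ^ 2) * E / Δ * K +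
        3 * (24 + 2 * Q) * (1 / 2 + 1 / l) * E / (Δ * L ^ 2)) +
        (24 + 2 * Q) * (1 / 2 + 1 / l) ^ 2 / L ^ 2 + 9 / (1 / l) ^ 2) ≤
        1 * (6104 * (L / l ^ 2)) := by
    have : 1 / π ≤ 1 := by rw [div_le_one pi_pos]; linarith
    have h6 : 0 ≤ L / l ^ 2 := by positivity
    calc _ ≤ 1 / π * (6104 * (L / l ^ 2)) := by
          gcongr
          linarith
      _ ≤ _ := by gcongr
  have e2 : 10000 * (L * m) / l ^ 2 = 10000 * (L * m / l ^ 2) := by ring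
  have h7 : 0 ≤ L / l ^ 2 := by positivity
  rw [e2]
  linear_combination t1 + hsum + 6104 * hXm + 3796 * hXm + 3796 * h7

theorem RiemannHypothesis.abs_S_le_main (hRH : RiemannHypothesis) {t u : ℝ} (ht : 100 ≤ t)
    (hm : 1 ≤ Real.log (Real.log (Real.log t)))
    (hl : 12 * Real.log (Real.log (Real.log t)) ≤ Real.log (Real.log t))
    (hL : 9 * Real.log (Real.log t) ^ 4 ≤ Real.log t) (hLt : Real.log t + 6 ≤ t / 2)
    (htu : t ≤ u) (hut : u ≤ 2 * t) (hz : ¬ IsZetaZeroOrdinate u) :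
    |S u| ≤ 1 / 4 * Real.log t / Real.log (Real.log t) +
      10000 * (Real.log t * Real.log (Real.log (Real.log t))) / Real.log (Real.log t) ^ 2 := by
  have ht0 : 0 < t := by linarith
  set L := Real.log t with hLdef
  set l := Real.log L with hldef
  set m := Real.log l with hmdef
  have hl12 : 12 ≤ l := by linarith
  have hl4 : l ≤ l ^ 4 := le_self_pow₀ (by linarith) (by norm_num)
  have hL1 : 100 ≤ L := by linarith
  have hl0 : 0 < l := by linarith
  have hlog : ∀ c : ℝ, 0 ≤ c → c ≤ 6 → Real.log (u + L + c) ≤ L + 2 := by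
    intro c hc hc6
    calc Real.log (u + L + c) ≤ Real.log (t * 4) := by
          apply Real.log_le_log <;> linarith
      _ = L + 2 * Real.log 2 := by
          rw [Real.log_mul (by linarith) (by norm_num), show (4 : ℝ) = 2 ^ 2 by norm_num,
            Real.log_pow]
          norm_num [hLdef]
      _ ≤ L + 2 := by linarith [Real.log_two_lt_d9]
  have hd : 1 / l ≤ 1 / 12 := one_div_le_one_div_of_le (by norm_num) hl12
  have hd0 : 0 < 1 / l := by positivity
  have hπ4 := pi_le_four
  have hΔ0 : 0 < (l - 6 * m) / π := div_pos (by linarith) pi_pos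
  have hEq : 2 * π * ((l - 6 * m) / π * (1 / 2 + 1 / l)) = (l - 6 * m) * (1 + 2 / l) := by
    field_simp
  have hE : Real.exp (2 * π * ((l - 6 * m) / π * (1 / 2 + 1 / l))) ≤ 9 * (L / l ^ 6) := by
    rw [hEq]
    have h1 : (l - 6 * m) * (1 + 2 / l) ≤ 1 + 1 + l - m * 6 := by
      have : 0 ≤ m / l := by positivity
      have h2 : (l - 6 * m) * (1 + 2 / l) = 1 + 1 + l - m * 6 - 12 * (m / l) := by
        field_simp; ring
      linarith
    have h6 : Real.exp (m * 6) = l ^ 6 := by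
      rw [show m * 6 = (6 : ℕ) * m by push_cast; ring, Real.exp_nat_mul, Real.exp_log hl0]
    calc _ ≤ Real.exp (1 + 1 + l - m * 6) := Real.exp_le_exp.2 h1
      _ = Real.exp 1 * Real.exp 1 * (L / l ^ 6) := by
          rw [Real.exp_sub, Real.exp_add, Real.exp_add, h6, Real.exp_log (by linarith)]
          ring
      _ ≤ 3 * 3 * (L / l ^ 6) := by
          have := Real.exp_one_lt_three.le
          gcongr
      _ = _ := by norm_num
  have hK : Real.log (2 * L + 1) ≤ 2 * l := by
    calc Real.log (2 * L + 1) ≤ Real.log (L ^ 2) := by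
          apply Real.log_le_log <;> nlinarith
      _ = 2 * l := by rw [Real.log_pow]; norm_num [hldef]
  have hΔδ : 1 ≤ (l - 6 * m) / π * (1 / 2 + 1 / l) := by
    have h1 : l / 2 * (1 / 2 + 1 / l) ≤ (l - 6 * m) * (1 / 2 + 1 / l) := by
      gcongr
      linarith
    have h2 : l / 2 * (1 / 2 + 1 / l) = l / 4 + 1 / 2 := by field_simp; ring
    rw [div_mul_eq_mul_div, one_le_div pi_pos]
    linarith [pi_lt_d2]
  refine (hRH.abs_S_le (u := u) (T := L) (δ := 1 / l) (Δ := (l - 6 * m) / π) hd0 (by linarith)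
    (by linarith) (by linarith) hΔ0 hΔδ hz).trans ?_
  exact argument_bound_le hm hl hL hE (Real.exp_pos _).le rfl (hlog 4 (by norm_num) (by norm_num))
    (Real.log_nonneg (by linarith)) (hlog 6 (by norm_num) le_rfl)
    (Real.log_nonneg (by linarith)) hK

theorem abs_S_diff_le (hRH : RiemannHypothesis) :
    ∃ C > 0, ∃ t₀ : ℝ, ∀ t ≥ t₀, ∀ h : ℝ, 0 < h → h ≤ Real.sqrt t →
      ¬ IsZetaZeroOrdinate t → ¬ IsZetaZeroOrdinate (t + h) →
      |S (t + h) - S t| ≤ (1 / 2) * Real.log t / Real.log (Real.log t) +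
        C * (Real.log t * Real.log (Real.log (Real.log t))) / (Real.log (Real.log t)) ^ 2 := by
  have hlog1 := Real.tendsto_log_atTop
  have hlog2 := hlog1.comp hlog1
  have hlog3 := hlog1.comp hlog2
  have hlin : ∀ᶠ x : ℝ in Filter.atTop, 12 * Real.log x ≤ x := by
    filter_upwards [Real.isLittleO_log_id_atTop.bound (by norm_num : (0 : ℝ) < 1 / 12),
      Filter.eventually_ge_atTop 1] with x hx hx1
    rw [Real.norm_eq_abs, Real.norm_eq_abs, id, abs_of_nonneg (Real.log_nonneg hx1),
      abs_of_nonneg (by linarith)] at hx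
    linarith
  have hpow : ∀ᶠ x : ℝ in Filter.atTop, 9 * Real.log x ^ 4 ≤ x := by
    have := Real.isLittleO_pow_log_id_atTop (n := 4)
    filter_upwards [this.bound (by norm_num : (0 : ℝ) < 1 / 9),
      Filter.eventually_ge_atTop 1] with x hx hx1
    rw [Real.norm_eq_abs, Real.norm_eq_abs, id, abs_of_nonneg (by positivity),
      abs_of_nonneg (by linarith)] at hx
    linarith
  obtain ⟨t₀, ht₀⟩ := Filter.eventually_atTop.1 ((Filter.eventually_ge_atTop (100 : ℝ)).and
    ((hlog3.eventually_ge_atTop 1).and ((hlog2.eventually hlin).and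
      ((hlog1.eventually hpow).and hlin))))
  refine ⟨20000, by norm_num, t₀, fun t ht h hh0 hh hz hz' => ?_⟩
  obtain ⟨h1, h2, h3, h4, h5⟩ := ht₀ t ht
  simp only [Function.comp_apply] at h2 h3
  have hs : Real.sqrt t ≤ t := by
    rw [Real.sqrt_le_left (by linarith)]
    nlinarith
  have a1 := hRH.abs_S_le_main h1 h2 h3 h4 (by linarith) le_rfl (by linarith) hz
  have a2 := hRH.abs_S_le_main h1 h2 h3 h4 (by linarith) (by linarith : t ≤ t + h) (by linarith) hz'
  refine (abs_sub _ _).trans ((add_le_add a2 a1).trans (le_of_eq ?_))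
  ring
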